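/- arXiv:2201.07957 — 2 statements merged into one kernel-verified Lean document; each statement's English description precedes it below -/
import Mathlib

section
/- Let γ = 3 and λ < 0. Suppose the initial data (τ₀,u₀) ∈ C¹(ℝ) satisfy ‖u₀‖_{C¹} ≤ C₀, ‖τ₀‖_{C¹} ≤ C₀ and C₀⁻¹ < τ₀(x) for all x, for some constant C₀ > 0, and let (τ,u) be a C¹ solution of the system on ℝ × [0,∞). Then ‖u‖_{L∞} is uniformly bounded for all time, and there exists a constant M̂ > 0 depending only on C₀, K, γ, λ and α such that the density ρ = τ⁻¹ satisfies ρ(x,t) ≥ C₀⁻¹ exp(−M̂ t e^{−λ(1+t)^{1−λ}/(1−λ)}) for all (x,t) ∈ ℝ × [0,∞); in particular, vacuum never occurs in finite time. -/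
open Real Set MeasureTheory

/-- Partial derivative in the space variable `x`. -/
noncomputable def pdx (f : ℝ → ℝ → ℝ) (x t : ℝ) : ℝ := deriv (fun y => f y t) x

/-- Partial derivative in the time variable `t`. -/
noncomputable def pdt (f : ℝ → ℝ → ℝ) (x t : ℝ) : ℝ := deriv (fun s => f x s) t

/-- `(τ, u)` is a `C¹` solution of the compressible Euler equations with
time-dependent damping `τ_t - u_x = 0`, `u_t + p_x = -(α/(1+t)^λ) u`,
`p = K τ^{-γ}`, on `ℝ × [0,∞)`. -/
def IsSol (K γ α lam : ℝ) (τ u : ℝ → ℝ → ℝ) : Prop :=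
  ContDiff ℝ 1 (fun p : ℝ × ℝ => τ p.1 p.2) ∧
  ContDiff ℝ 1 (fun p : ℝ × ℝ => u p.1 p.2) ∧
  (∀ x t, 0 ≤ t → 0 < τ x t) ∧
  (∀ x t, 0 ≤ t → pdt τ x t = pdx u x t) ∧
  (∀ x t, 0 ≤ t →
    pdt u x t + pdx (fun y s => K * τ y s ^ (-γ)) x t = -(α / (1 + t) ^ lam) * u x t)

/-- `φ = (2√(Kγ)/(γ-1)) τ^{-(γ-1)/2}`. -/
noncomputable def Phi (K γ : ℝ) (τ : ℝ → ℝ → ℝ) (x t : ℝ) : ℝ :=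
  (2 * Real.sqrt (K * γ) / (γ - 1)) * τ x t ^ (-(γ - 1) / 2)

/-- `K_τ = (2√(Kγ)/(γ-1))^{2/(γ-1)}`. -/
noncomputable def Ktau (K γ : ℝ) : ℝ := (2 * Real.sqrt (K * γ) / (γ - 1)) ^ (2 / (γ - 1))

/-- `K_c = √(Kγ) K_τ^{-(γ+1)/2}`. -/
noncomputable def Kc (K γ : ℝ) : ℝ := Real.sqrt (K * γ) * Ktau K γ ^ (-(γ + 1) / 2)

/-- Blow-up of `‖(τ_x, u_x)‖_{L^∞}` in finite time. -/
def BlowsUp (τ u : ℝ → ℝ → ℝ) : Prop :=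
  ∃ T > (0 : ℝ),
    ¬ BddAbove {r : ℝ | ∃ x t, 0 ≤ t ∧ t ≤ T ∧ r = |pdx τ x t| + |pdx u x t|}

open Filter Topology

/-- `F` is continuously differentiable near every point of the closed half-plane `t ≥ 0`. -/
def C1Half (F : ℝ → ℝ → ℝ) : Prop :=
  ∀ x t, 0 ≤ t → ContDiffAt ℝ 1 (fun p : ℝ × ℝ => F p.1 p.2) (x, t)

namespace C1Half

variable {F : ℝ → ℝ → ℝ}

lemma fderiv_apply (hF : C1Half F) {x t : ℝ} (ht : 0 ≤ t) (v w : ℝ) :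
    fderiv ℝ (fun p : ℝ × ℝ => F p.1 p.2) (x, t) (v, w) = v * pdx F x t + w * pdt F x t := by
  have hd := ((hF x t ht).differentiableAt one_ne_zero).hasFDerivAt
  have hx : pdx F x t = fderiv ℝ (fun p : ℝ × ℝ => F p.1 p.2) (x, t) (1, 0) :=
    (hd.comp_hasDerivAt (f := fun y => (y, t)) x ((hasDerivAt_id x).prodMk (hasDerivAt_const x t))).deriv
  have hT : pdt F x t = fderiv ℝ (fun p : ℝ × ℝ => F p.1 p.2) (x, t) (0, 1) :=
    (hd.comp_hasDerivAt (f := fun r => (x, r)) t ((hasDerivAt_const t x).prodMk (hasDerivAt_id t))).deriv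
  have : ((v, w) : ℝ × ℝ) = v • (1, 0) + w • (0, 1) := by simp
  rw [this, map_add, map_smul, map_smul, hx, hT, smul_eq_mul, smul_eq_mul]

lemma hasDerivWithinAt_comp (hF : C1Half F) {X : ℝ → ℝ} {v t : ℝ} {S : Set ℝ} (ht : 0 ≤ t)
    (hX : HasDerivWithinAt X v S t) :
    HasDerivWithinAt (fun r => F (X r) r) (pdt F (X t) t + v * pdx F (X t) t) S t := by
  have h := ((hF (X t) t ht).differentiableAt one_ne_zero).hasFDerivAt.comp_hasDerivWithinAt
    (f := fun r => (X r, r)) t (hX.prodMk (hasDerivWithinAt_id t S))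
  rw [hF.fderiv_apply ht] at h
  exact h.congr_deriv (by ring)

lemma hasDerivAt_x (hF : C1Half F) {x t : ℝ} (ht : 0 ≤ t) :
    HasDerivAt (fun y => F y t) (pdx F x t) x := by
  have h := ((hF x t ht).differentiableAt one_ne_zero).hasFDerivAt.comp_hasDerivAt
    (f := fun y => (y, t)) x ((hasDerivAt_id x).prodMk (hasDerivAt_const x t))
  exact h.differentiableAt.hasDerivAt

lemma hasDerivAt_t (hF : C1Half F) {x t : ℝ} (ht : 0 ≤ t) :
    HasDerivAt (fun r => F x r) (pdt F x t) t := by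
  have h := ((hF x t ht).differentiableAt one_ne_zero).hasFDerivAt.comp_hasDerivAt
    (f := fun r => (x, r)) t ((hasDerivAt_const t x).prodMk (hasDerivAt_id t))
  exact h.differentiableAt.hasDerivAt

lemma continuousAt (hF : C1Half F) {x t : ℝ} (ht : 0 ≤ t) :
    ContinuousAt (fun p : ℝ × ℝ => F p.1 p.2) (x, t) :=
  (hF x t ht).continuousAt

lemma continuousAt_pdx (hF : C1Half F) {x t : ℝ} (ht : 0 ≤ t) :
    ContinuousAt (fun p : ℝ × ℝ => fderiv ℝ (fun p : ℝ × ℝ => F p.1 p.2) p (1, 0)) (x, t) :=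
  (((hF x t ht).fderiv_right (m := 0) le_rfl).continuousAt).clm_apply continuousAt_const

lemma continuousOn_pdx (hF : C1Half F) :
    ContinuousOn (fun p : ℝ × ℝ => pdx F p.1 p.2) {p | 0 ≤ p.2} := by
  intro p hp
  refine ((hF.continuousAt_pdx (x := p.1) hp).continuousWithinAt).congr (fun y hy => ?_) ?_
  · simpa using (hF.fderiv_apply (x := y.1) hy 1 0).symm
  · simpa using (hF.fderiv_apply (x := p.1) hp 1 0).symm

lemma continuousOn (hF : C1Half F) :
    ContinuousOn (fun p : ℝ × ℝ => F p.1 p.2) {p | 0 ≤ p.2} :=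
  fun p hp => (hF.continuousAt (x := p.1) hp).continuousWithinAt

lemma tendsto_slope (hF : C1Half F) {X : ℝ → ℝ} {t : ℝ} (ht : 0 ≤ t) (hX : ContinuousAt X t) :
    Tendsto (fun p : ℝ × ℝ => (F (X p.2 + p.1) p.2 - F (X p.2) p.2) / p.1)
      (𝓝[≠] 0 ×ˢ 𝓝 t) (𝓝 (pdx F (X t) t)) := by
  have hs := ((hF (X t) t ht).hasStrictFDerivAt one_ne_zero).isLittleO
  have h1 : Tendsto (fun p : ℝ × ℝ => p.1) (𝓝[≠] (0 : ℝ) ×ˢ 𝓝 t) (𝓝 0) :=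
    tendsto_fst.mono_right nhdsWithin_le_nhds
  have h2 : Tendsto (fun p : ℝ × ℝ => p.2) (𝓝[≠] (0 : ℝ) ×ˢ 𝓝 t) (𝓝 t) := tendsto_snd
  have h3 : Tendsto (fun p : ℝ × ℝ => X p.2) (𝓝[≠] (0 : ℝ) ×ˢ 𝓝 t) (𝓝 (X t)) := hX.tendsto.comp h2
  have hmap : Tendsto (fun p : ℝ × ℝ => ((X p.2 + p.1, p.2), (X p.2, p.2)))
      (𝓝[≠] (0 : ℝ) ×ˢ 𝓝 t) (𝓝 ((X t, t), (X t, t))) := by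
    refine Tendsto.prodMk_nhds (Tendsto.prodMk_nhds ?_ h2) (h3.prodMk_nhds h2)
    simpa using h3.add h1
  have ho := hs.comp_tendsto hmap
  have hne : ∀ᶠ p : ℝ × ℝ in 𝓝[≠] (0 : ℝ) ×ˢ 𝓝 t, p.1 ≠ 0 :=
    tendsto_fst.eventually self_mem_nhdsWithin
  have ho' : (fun p : ℝ × ℝ => F (X p.2 + p.1) p.2 - F (X p.2) p.2 - p.1 * pdx F (X t) t)
      =o[𝓝[≠] (0 : ℝ) ×ˢ 𝓝 t] fun p => p.1 := by
    refine (ho.congr_left fun p => ?_).trans_isBigO (Asymptotics.IsBigO.of_bound 1 ?_)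
    · simp [hF.fderiv_apply ht]
    · simp [Prod.norm_def]
  have h0 := ho'.tendsto_div_nhds_zero
  refine (tendsto_sub_nhds_zero_iff.mp (h0.congr' ?_))
  filter_upwards [hne] with p hp
  field_simp

/-- If `v_t + c v_x = R`, then `v_x` is differentiable along the curves `X' = c(X, t)`. -/
lemma hasDerivAt_pdx_characteristic {v c R : ℝ → ℝ → ℝ} (hv : C1Half v) (hc : C1Half c)
    (hR : C1Half R) (heq : ∀ x t, 0 ≤ t → pdt v x t + c x t * pdx v x t = R x t)
    {X : ℝ → ℝ} {T : ℝ} (hX : ∀ t ∈ Ioo 0 T, HasDerivAt X (c (X t) t) t) {t : ℝ}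
    (ht : t ∈ Ioo 0 T) :
    HasDerivAt (fun r => pdx v (X r) r)
      (pdx R (X t) t - pdx c (X t) t * pdx v (X t) t) t := by
  have hXc : ContinuousAt X t := (hX t ht).continuousAt
  have hcont : ∀ {F : ℝ → ℝ → ℝ}, C1Half F → ContinuousAt (fun r => pdx F (X r) r) t := by
    intro F hF
    have hc := (hF.continuousOn_pdx (X t, t) ht.1.le).continuousAt (by
      have : {p : ℝ × ℝ | 0 < p.2} ∈ 𝓝 (X t, t) :=
        (isOpen_lt continuous_const continuous_snd).mem_nhds ht.1
      filter_upwards [this] with p hp using le_of_lt hp)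
    exact ContinuousAt.comp (f := fun r => (X r, r))
      (g := fun p : ℝ × ℝ => pdx F p.1 p.2) hc (hXc.prodMk continuousAt_id)
  have hIoo : Ioo 0 T ∈ 𝓝 t := Ioo_mem_nhds ht.1 ht.2
  refine hasDerivAt_of_tendstoUniformlyOnFilter (l := 𝓝[≠] (0 : ℝ))
    (f := fun h r => (v (X r + h) r - v (X r) r) / h)
    (f' := fun h r => (R (X r + h) r - R (X r) r) / h
      - (c (X r + h) r - c (X r) r) / h * pdx v (X r + h) r)
    (g' := fun r => pdx R (X r) r - pdx c (X r) r * pdx v (X r) r) ?_ ?_ ?_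
  · rw [tendstoUniformlyOnFilter_iff_tendsto]
    refine Tendsto.mono_right ?_ (nhds_le_uniformity (pdx R (X t) t - pdx c (X t) t * pdx v (X t) t))
    have h2 : Tendsto (fun p : ℝ × ℝ => p.2) (𝓝[≠] (0 : ℝ) ×ˢ 𝓝 t) (𝓝 t) := tendsto_snd
    have h1 : Tendsto (fun p : ℝ × ℝ => p.1) (𝓝[≠] (0 : ℝ) ×ˢ 𝓝 t) (𝓝 0) :=
      tendsto_fst.mono_right nhdsWithin_le_nhds
    refine Tendsto.prodMk_nhds ?_ ?_
    · exact (((hcont hR).sub ((hcont hc).mul (hcont hv))).tendsto).comp h2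
    · refine (hR.tendsto_slope ht.1.le hXc).sub ((hc.tendsto_slope ht.1.le hXc).mul ?_)
      have hcw := hv.continuousOn_pdx (X t, t) ht.1.le
      refine Tendsto.comp (f := fun p : ℝ × ℝ => (X p.2 + p.1, p.2))
        (g := fun p : ℝ × ℝ => pdx v p.1 p.2) hcw ?_
      refine tendsto_nhdsWithin_iff.mpr ⟨Tendsto.prodMk_nhds ?_ h2, ?_⟩
      · simpa using (hXc.tendsto.comp h2).add h1
      · filter_upwards [h2.eventually hIoo] with p hp using hp.1.le
  · rw [eventually_prod_iff]
    refine ⟨fun h => h ≠ 0, self_mem_nhdsWithin, fun r => r ∈ Ioo 0 T, hIoo, ?_⟩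
    intro h hh r hr
    have d1 := (hv.hasDerivWithinAt_comp (X := fun r => X r + h) (S := univ) hr.1.le
      ((hX r hr).add_const h).hasDerivWithinAt).hasDerivAt univ_mem
    have d2 := (hv.hasDerivWithinAt_comp (S := univ) hr.1.le
      (hX r hr).hasDerivWithinAt).hasDerivAt univ_mem
    refine ((d1.sub d2).div_const h).congr_deriv ?_
    have e1 := heq (X r + h) r hr.1.le
    have e2 := heq (X r) r hr.1.le
    rw [← e1, ← e2]
    field_simp
    ring
  · filter_upwards [hIoo] with r hr
    have h := (hv.tendsto_slope hr.1.le (hX r hr).continuousAt)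
    exact h.comp (tendsto_id.prodMk tendsto_const_nhds)

end C1Half

lemma nonneg_of_hasDerivWithinAt_Iio_of_le {F : ℝ → ℝ} {d t : ℝ}
    (h : HasDerivWithinAt F d (Iio t) t) (hmax : ∀ᶠ r in 𝓝[<] t, F r ≤ F t) : 0 ≤ d := by
  rw [hasDerivWithinAt_iff_tendsto_slope' self_notMem_Iio] at h
  refine ge_of_tendsto h ?_
  filter_upwards [hmax, self_mem_nhdsWithin] with r hr hrt
  rw [slope_def_field]
  exact div_nonneg_of_nonpos (by linarith) (by linarith [mem_Iio.mp hrt])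

/-- The Euler system with `γ = 3` in terms of `s = u + φ` and `q = φ - u`, where `φ = k / τ`. -/
structure RiemannSol (k : ℝ) (a : ℝ → ℝ) (s q : ℝ → ℝ → ℝ) : Prop where
  c1s : C1Half s
  c1q : C1Half q
  pos : ∀ x t, 0 ≤ t → 0 < s x t + q x t
  eqs : ∀ x t, 0 ≤ t →
    pdt s x t + (s x t + q x t) ^ 2 / (4 * k) * pdx s x t = -(a t / 2) * (s x t - q x t)
  eqq : ∀ x t, 0 ≤ t →
    pdt q x t - (s x t + q x t) ^ 2 / (4 * k) * pdx q x t = a t / 2 * (s x t - q x t)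

lemma pdx_reflect (F : ℝ → ℝ → ℝ) (x t : ℝ) :
    pdx (fun y r => F (-y) r) x t = -pdx F (-x) t :=
  deriv_comp_neg (fun y => F y t) x

lemma C1Half.reflect {F : ℝ → ℝ → ℝ} (hF : C1Half F) : C1Half (fun x t => F (-x) t) := by
  intro x t ht
  exact (hF (-x) t ht).comp (f := fun p : ℝ × ℝ => (-p.1, p.2))
    (g := fun p : ℝ × ℝ => F p.1 p.2) (x, t) (by fun_prop)

namespace RiemannSol

variable {k : ℝ} {a : ℝ → ℝ} {s q : ℝ → ℝ → ℝ}

lemma reflect (h : RiemannSol k a s q) :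
    RiemannSol k a (fun x t => q (-x) t) (fun x t => s (-x) t) where
  c1s := h.c1q.reflect
  c1q := h.c1s.reflect
  pos x t ht := by linarith [h.pos (-x) t ht]
  eqs x t ht := by
    have := h.eqq (-x) t ht
    rw [pdx_reflect]
    change pdt q (-x) t + _ = _
    rw [add_comm (q (-x) t)]
    linarith
  eqq x t ht := by
    have := h.eqs (-x) t ht
    rw [pdx_reflect]
    change pdt s (-x) t - _ = _
    rw [add_comm (q (-x) t)]
    linarith

lemma c1_speed (h : RiemannSol k a s q) :
    C1Half (fun x t => (s x t + q x t) ^ 2 / (4 * k)) := by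
  intro x t ht
  have h1 := h.c1s x t ht
  have h2 := h.c1q x t ht
  fun_prop

lemma pdx_speed (h : RiemannSol k a s q) {x t : ℝ} (ht : 0 ≤ t) :
    pdx (fun x t => (s x t + q x t) ^ 2 / (4 * k)) x t
      = (s x t + q x t) * (pdx s x t + pdx q x t) / (2 * k) := by
  have := ((((h.c1s.hasDerivAt_x (x := x) ht).add (h.c1q.hasDerivAt_x ht)).pow 2).div_const
    (4 * k)).deriv
  refine this.trans ?_
  simp only [Pi.add_apply, Nat.cast_ofNat]
  rcases eq_or_ne k 0 with rfl | hk
  · simp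
  · field_simp
    ring

/-- On a box `[b, R] × [0, T]` no information enters through `x = R` for right-moving waves, so a
comparison function lying above `f` for `x = b` and `t = 0` stays above it. -/
lemma le_on_box_of_right_moving {f ψ : ℝ → ℝ → ℝ} {b R T : ℝ}
    (hf : C1Half f) (hψc : ContinuousOn (fun p : ℝ × ℝ => ψ p.1 p.2) (Icc b R ×ˢ Icc 0 T))
    {c ψx ψt : ℝ → ℝ → ℝ} (hc : ∀ x t, 0 ≤ t → 0 ≤ c x t)
    (hψx : ∀ x t, b < x → 0 < t → HasDerivAt (fun y => ψ y t) (ψx x t) x)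
    (hψt : ∀ x t, b < x → 0 < t → HasDerivAt (fun r => ψ x r) (ψt x t) t)
    (h0 : ∀ x, b ≤ x → f x 0 ≤ ψ x 0) (hb : ∀ t ∈ Icc 0 T, f b t ≤ ψ b t)
    (hsup : ∀ x t, b < x → 0 < t → t ≤ T → ψ x t < f x t →
      pdt f x t + c x t * pdx f x t < ψt x t + c x t * ψx x t) :
    ∀ x ∈ Icc b R, ∀ t ∈ Icc 0 T, f x t ≤ ψ x t := by
  intro x₀ hx₀ t₀ ht₀
  have hcont : ContinuousOn (fun p : ℝ × ℝ => f p.1 p.2 - ψ p.1 p.2) (Icc b R ×ˢ Icc 0 T) :=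
    (hf.continuousOn.mono fun p hp => hp.2.1).sub hψc
  obtain ⟨⟨x, t⟩, ⟨hx, ht⟩, hmax⟩ :=
    (isCompact_Icc.prod isCompact_Icc).exists_isMaxOn ⟨(x₀, t₀), hx₀, ht₀⟩ hcont
  simp only at hx ht
  have hmax' : ∀ y ∈ Icc b R, ∀ r ∈ Icc 0 T, f y r - ψ y r ≤ f x t - ψ x t :=
    fun y hy r hr => hmax (show (y, r) ∈ Icc b R ×ˢ Icc 0 T from ⟨hy, hr⟩)
  by_contra! hlt
  have hpos : ψ x t < f x t := by linarith [hmax' x₀ hx₀ t₀ ht₀]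
  have hbx : b < x := by
    refine lt_of_le_of_ne hx.1 fun hE => ?_
    subst hE
    linarith [hb t ht]
  have htpos : 0 < t := by
    refine lt_of_le_of_ne ht.1 fun hE => ?_
    subst hE
    linarith [h0 x hx.1]
  have d1 : 0 ≤ pdx f x t - ψx x t := by
    refine nonneg_of_hasDerivWithinAt_Iio_of_le
      ((hf.hasDerivAt_x ht.1).sub (hψx x t hbx htpos)).hasDerivWithinAt ?_
    filter_upwards [Ioo_mem_nhdsLT hbx] with y hy
    exact hmax' y ⟨hy.1.le, hy.2.le.trans hx.2⟩ t ht
  have d2 : 0 ≤ pdt f x t - ψt x t := by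
    refine nonneg_of_hasDerivWithinAt_Iio_of_le
      ((hf.hasDerivAt_t ht.1).sub (hψt x t hbx htpos)).hasDerivWithinAt ?_
    filter_upwards [Ioo_mem_nhdsLT htpos] with r hr
    exact hmax' x hx r ⟨hr.1.le, hr.2.le.trans ht.2⟩
  have := hsup x t hbx htpos ht.2 hpos
  nlinarith [hc x t ht.1]

lemma exists_bound_on_line {F : ℝ → ℝ → ℝ} (hF : C1Half F) (b T : ℝ) :
    ∃ C, ∀ t ∈ Icc 0 T, |F b t| ≤ C := by
  obtain ⟨C, hC⟩ := isCompact_Icc.exists_bound_of_continuousOn (s := Icc 0 T)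
    (f := fun t => F b t) (fun t ht => (hF.hasDerivAt_t ht.1).continuousAt.continuousWithinAt)
  exact ⟨C, hC⟩

/-- Although `q` is not controlled at infinity, `s` grows at most like `√x`. -/
lemma exists_sqrt_growth (h : RiemannSol k a s q) (hk : 0 < k) (hac : Continuous a)
    (ha : ∀ t, 0 ≤ t → 0 ≤ a t) {M : ℝ} (hM : ∀ x, |s x 0| ≤ M) (b T : ℝ) :
    ∃ A, ∀ x, b ≤ x → ∀ t ∈ Icc 0 T, s x t ≤ A * √(1 + x - b) := by
  obtain ⟨C, hC⟩ := exists_bound_on_line h.c1s b T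
  obtain ⟨D, hD⟩ := isCompact_Icc.exists_bound_of_continuousOn (s := Icc 0 T) hac.continuousOn
  set A := 1 + |M| + |C| with hA
  have hA1 : 1 ≤ A := by rw [hA]; linarith [abs_nonneg M, abs_nonneg C]
  set B := k * (D ^ 2 + 1) with hB
  have hB0 : 0 < B := by positivity
  refine ⟨A + B * |T|, fun x hx t ht => ?_⟩
  have hw1 : ∀ y, b ≤ y → 1 ≤ √(1 + y - b) := fun y hy => by
    rw [Real.one_le_sqrt]; linarith
  have hbound : s x t ≤ (A + B * t) * √(1 + x - b) := by
    refine le_on_box_of_right_moving (ψ := fun x t => (A + B * t) * √(1 + x - b)) (R := x)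
      (c := fun x t => (s x t + q x t) ^ 2 / (4 * k))
      (ψx := fun x t => (A + B * t) * (1 / (2 * √(1 + x - b))))
      (ψt := fun x t => B * √(1 + x - b)) h.c1s
      (by fun_prop) (fun _ _ _ => by positivity) ?_ ?_ ?_ ?_ ?_ x ⟨hx, le_rfl⟩ t ht
    · intro y r hy _
      have hd : HasDerivAt (fun y => 1 + y - b) 1 y := ((hasDerivAt_id y).const_add 1).sub_const b
      exact (hd.sqrt (by linarith)).const_mul _
    · intro y r _ _
      have hd : HasDerivAt (fun r => A + B * r) B r := by
        simpa using ((hasDerivAt_id r).const_mul B).const_add A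
      exact hd.mul_const _
    · intro y hy
      have h1 := (abs_le.mp (hM y)).2
      have h2 := hw1 y hy
      have h3 := le_abs_self M
      have h4 := abs_nonneg C
      simp only [mul_zero, add_zero]
      nlinarith
    · intro r hr
      have h1 := (abs_le.mp (hC r hr)).2
      have h3 := le_abs_self C
      have h4 := abs_nonneg M
      have h5 : 0 ≤ B * r := mul_nonneg hB0.le hr.1
      have h6 : √(1 + b - b) = 1 := by simp
      rw [h6]
      linarith
    · intro y r hy hr hrT hlt
      rw [h.eqs y r hr.le]
      have hw := hw1 y hy.le
      set w := √(1 + y - b) with hw_def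
      have hφ := h.pos y r hr.le
      have har := ha r hr.le
      have haD : a r ≤ D := (le_abs_self _).trans (hD r ⟨hr.le, hrT⟩)
      have hs : 0 < s y r := by
        refine lt_trans ?_ hlt
        positivity
      have hlhs : -(a r / 2) * (s y r - q y r) ≤ D * ((s y r + q y r) / 2) := by
        nlinarith
      have hrhs : (s y r + q y r) ^ 2 / (4 * k) * (1 * (1 / (2 * w)))
          ≤ (s y r + q y r) ^ 2 / (4 * k) * ((A + B * r) * (1 / (2 * w))) := by
        gcongr
        nlinarith
      refine lt_of_le_of_lt hlhs (lt_of_lt_of_le ?_ (add_le_add_right hrhs _))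
      set φ := (s y r + q y r) / 2 with hφd
      have e : (s y r + q y r) ^ 2 / (4 * k) * (1 * (1 / (2 * w))) = φ ^ 2 / (2 * k * w) := by
        rw [hφd]; field_simp; ring
      rw [e, hB, ← sub_pos]
      have hw0 : 0 < w := by linarith
      have e2 : k * (D ^ 2 + 1) * w + φ ^ 2 / (2 * k * w) - D * φ
          = ((φ - k * w * D) ^ 2 + (k * w) ^ 2 * (D ^ 2 + 2)) / (2 * k * w) := by
        field_simp; ring
      rw [e2]
      positivity
  refine hbound.trans ?_
  have : t ≤ |T| := ht.2.trans (le_abs_self T)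
  gcongr

lemma exists_lower_bound (h : RiemannSol k a s q) (hk : 0 < k)
    (ha : ∀ t, 0 ≤ t → 0 ≤ a t) {M : ℝ} (hM : ∀ x, |s x 0| ≤ M) (b T : ℝ) :
    ∃ A, ∀ x, b ≤ x → ∀ t ∈ Icc 0 T, -A ≤ s x t := by
  obtain ⟨C, hC⟩ := exists_bound_on_line h.c1s b T
  refine ⟨|M| + |C| + |T|, fun x hx t ht => ?_⟩
  have hc1 : C1Half (fun x t => -s x t) := fun x t ht => (h.c1s x t ht).neg
  have key : -s x t ≤ |M| + |C| + t := by
    refine le_on_box_of_right_moving (f := fun x t => -s x t) (ψ := fun x t => |M| + |C| + t)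
      (R := x) (c := fun x t => (s x t + q x t) ^ 2 / (4 * k)) (ψx := fun _ _ => 0)
      (ψt := fun _ _ => 1) hc1 (by fun_prop) (fun _ _ _ => by positivity) ?_ ?_ ?_ ?_ ?_
      x ⟨hx, le_rfl⟩ t ht
    · intro y r _ _
      exact hasDerivAt_const _ _
    · intro y r _ _
      exact (hasDerivAt_id r).const_add _
    · intro y _
      linarith [(abs_le.mp (hM y)).1, le_abs_self M, abs_nonneg C]
    · intro r hr
      linarith [(abs_le.mp (hC r hr)).1, le_abs_self C, abs_nonneg M, hr.1]
    · intro y r _ hr _ hlt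
      have e1 : pdt (fun x t => -s x t) y r = -pdt s y r := deriv.fun_neg
      have e2 : pdx (fun x t => -s x t) y r = -pdx s y r := deriv.fun_neg
      have e := h.eqs y r hr.le
      have hp := h.pos y r hr.le
      have : s y r < 0 := by linarith [abs_nonneg M, abs_nonneg C]
      rw [e1, e2]
      nlinarith [ha r hr.le]
  linarith [ht.2, le_abs_self T]

end RiemannSol

lemma monotoneOn_Icc_of_hasDerivWithinAt {f f' : ℝ → ℝ} {t₀ t₁ : ℝ}
    (hf : ∀ t ∈ Icc t₀ t₁, HasDerivWithinAt f (f' t) (Icc t₀ t₁) t)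
    (h0 : ∀ t ∈ Icc t₀ t₁, 0 ≤ f' t) : MonotoneOn f (Icc t₀ t₁) :=
  monotoneOn_of_hasDerivWithinAt_nonneg (convex_Icc _ _)
    (fun t ht => (hf t ht).continuousWithinAt)
    (fun t ht => (hf t (interior_subset ht)).mono interior_subset)
    (fun t ht => h0 t (interior_subset ht))

/-- A backward integral curve of the field `-v` with its space variable clamped to `[b, R]`. -/
lemma exists_clamped_curve {v : ℝ → ℝ → ℝ} (hv : C1Half v) {b R T : ℝ} (hbR : b ≤ R)
    (hT : 0 ≤ T) :
    ∃ Y : ℝ → ℝ, Y T = b ∧ ∀ t ∈ Icc 0 T,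
      HasDerivWithinAt Y (-v (max b (min (Y t) R)) t) (Icc 0 T) t := by
  have hcpt : IsCompact (Icc b R ×ˢ Icc (0 : ℝ) T) := isCompact_Icc.prod isCompact_Icc
  have hsub : Icc b R ×ˢ Icc (0 : ℝ) T ⊆ {p : ℝ × ℝ | 0 ≤ p.2} := fun p hp => hp.2.1
  obtain ⟨L, hL⟩ := hcpt.exists_bound_of_continuousOn (hv.continuousOn.mono hsub)
  obtain ⟨N, hN⟩ := hcpt.exists_bound_of_continuousOn (hv.continuousOn_pdx.mono hsub)
  have hclamp : ∀ x, max b (min x R) ∈ Icc b R := fun x =>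
    ⟨le_max_left _ _, max_le hbR (min_le_right _ _)⟩
  have hLip : LipschitzWith 1 (fun x : ℝ => max b (min x R)) :=
    (LipschitzWith.id.min_const R).const_max b
  have hPL : IsPicardLindelof (fun t x => -v (max b (min x R)) t)
      (⟨T, hT, le_rfl⟩ : Icc (0 : ℝ) T) b (L.toNNReal * T.toNNReal) 0 L.toNNReal N.toNNReal := by
    refine ⟨fun t ht => ?_, fun x _ => ?_, fun t ht x _ => ?_, ?_⟩
    · have h1 : LipschitzOnWith N.toNNReal (fun x => v x t) (Icc b R) := by
        refine Convex.lipschitzOnWith_of_nnnorm_deriv_le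
          (fun x _ => (hv.hasDerivAt_x ht.1).differentiableAt) (fun x hx => ?_) (convex_Icc b R)
        rw [← NNReal.coe_le_coe, coe_nnnorm]
        exact (hN (x, t) ⟨hx, ht⟩).trans (Real.le_coe_toNNReal N)
      have h2 := h1.comp (hLip.lipschitzOnWith (s := Metric.closedBall b
        ((L.toNNReal * T.toNNReal : NNReal) : ℝ))) (fun x _ => hclamp x)
      rw [mul_one] at h2
      exact h2.neg
    · intro t ht
      exact (hv.hasDerivAt_t ht.1).continuousAt.continuousWithinAt.neg
    · rw [norm_neg]
      exact (hL (_, t) ⟨hclamp x, ht⟩).trans (Real.le_coe_toNNReal L)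
    · simp [hT]
  exact hPL.exists_eq_forall_mem_Icc_hasDerivWithinAt₀

namespace RiemannSol

variable {k : ℝ} {a : ℝ → ℝ} {s q : ℝ → ℝ → ℝ}

lemma left_moving_displacement_le (h : RiemannSol k a s q) (hk : 0 < k) (hac : Continuous a)
    (ha : ∀ t, 0 ≤ t → 0 ≤ a t) {b T A A' : ℝ}
    (hup : ∀ x, b ≤ x → ∀ t ∈ Icc 0 T, s x t ≤ A * √(1 + x - b))
    (hlow : ∀ x, b ≤ x → ∀ t ∈ Icc 0 T, -A' ≤ s x t) :
    ∃ C, ∀ (Y : ℝ → ℝ), ∀ t₁ ∈ Icc 0 T, Y T = b → (∀ t ∈ Icc t₁ T, b ≤ Y t) →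
      (∀ t ∈ Icc t₁ T, HasDerivWithinAt Y (-((s (Y t) t + q (Y t) t) ^ 2 / (4 * k)))
        (Icc t₁ T) t) → Y t₁ ≤ C := by
  set E : ℝ → ℝ := fun t => ∫ r in (0 : ℝ)..t, a r / 2 with hE
  have hEd : ∀ t, HasDerivAt E (a t / 2) t := fun t =>
    (hac.div_const 2).integral_hasStrictDerivAt 0 t |>.hasDerivAt
  have hE0 : ∀ t, 0 ≤ t → 0 ≤ E t := fun t ht =>
    intervalIntegral.integral_nonneg ht fun r hr => by linarith [ha r hr.1]
  set Q := |q b T + A'| * exp (E T) + |A'| with hQ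
  have hQ0 : 0 ≤ Q := by positivity
  set β := (A + Q) ^ 2 / (4 * k) with hβ
  refine ⟨exp (β * T) + b - 1, fun Y t₁ ht₁ hYT hYb hY => ?_⟩
  have hpos : ∀ t ∈ Icc t₁ T, 0 ≤ t := fun t ht => ht₁.1.trans ht.1
  have hTmem : T ∈ Icc t₁ T := ⟨ht₁.2, le_rfl⟩
  have hmono : MonotoneOn (fun t => (q (Y t) t + A') * exp (E t)) (Icc t₁ T) := by
    refine monotoneOn_Icc_of_hasDerivWithinAt
      (f' := fun t => a t / 2 * (s (Y t) t + A') * exp (E t)) (fun t ht => ?_) (fun t ht => ?_)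
    · have d1 := h.c1q.hasDerivWithinAt_comp (hpos t ht) (hY t ht)
      have d2 := (hEd t).exp.hasDerivWithinAt (s := Icc t₁ T)
      refine ((d1.add_const A').mul d2).congr_deriv ?_
      have := h.eqq (Y t) t (hpos t ht)
      linear_combination (exp (E t)) * this
    · have h1 := hlow (Y t) (hYb t ht) t ⟨hpos t ht, ht.2⟩
      have h2 := ha t (hpos t ht)
      have h3 : 0 ≤ s (Y t) t + A' := by linarith
      positivity
  have hq : ∀ t ∈ Icc t₁ T, q (Y t) t ≤ Q := by
    intro t ht
    have h1 := hmono ht hTmem ht.2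
    simp only [hYT] at h1
    have h2 : (q b T + A') * exp (E T) ≤ |q b T + A'| * exp (E T) := by
      gcongr; exact le_abs_self _
    have h3 : 1 ≤ exp (E t) := Real.one_le_exp (hE0 t (hpos t ht))
    have h4 : q (Y t) t + A' ≤ |q b T + A'| * exp (E T) := by
      rcases le_total 0 (q (Y t) t + A') with h5 | h5
      · nlinarith
      · exact h5.trans (by positivity)
    linarith [neg_abs_le A']
  have hmono2 : MonotoneOn (fun t => (1 + Y t - b) * exp (β * t)) (Icc t₁ T) := by
    refine monotoneOn_Icc_of_hasDerivWithinAt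
      (f' := fun t => (-((s (Y t) t + q (Y t) t) ^ 2 / (4 * k)) + β * (1 + Y t - b)) * exp (β * t))
      (fun t ht => ?_) (fun t ht => ?_)
    · have d2 : HasDerivWithinAt (fun t => exp (β * t)) (exp (β * t) * (β * 1)) (Icc t₁ T) t :=
        ((hasDerivAt_id t).const_mul β).exp.hasDerivWithinAt
      refine ((((hY t ht).const_add 1).sub_const b).mul d2).congr_deriv ?_
      ring
    · refine mul_nonneg ?_ (exp_pos _).le
      have hb := hYb t ht
      have h1 := hup (Y t) hb t ⟨hpos t ht, ht.2⟩
      have h2 := hq t ht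
      have h3 := h.pos (Y t) t (hpos t ht)
      have hw1 : 1 ≤ √(1 + Y t - b) := by rw [Real.one_le_sqrt]; linarith
      have hw2 : √(1 + Y t - b) ^ 2 = 1 + Y t - b := Real.sq_sqrt (by linarith)
      have h4 : s (Y t) t + q (Y t) t ≤ (A + Q) * √(1 + Y t - b) := by nlinarith
      have h5 : (s (Y t) t + q (Y t) t) ^ 2 ≤ (A + Q) ^ 2 * (1 + Y t - b) := by
        rw [← hw2, ← mul_pow]
        exact pow_le_pow_left₀ h3.le h4 2
      have h6 : (s (Y t) t + q (Y t) t) ^ 2 / (4 * k) ≤ β * (1 + Y t - b) := by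
        rw [hβ, div_mul_eq_mul_div]
        gcongr
      linarith
  have h1 := hmono2 ⟨le_rfl, ht₁.2⟩ hTmem ht₁.2
  simp only [hYT] at h1
  have hβ0 : 0 ≤ β := by positivity
  have h2 : 1 ≤ exp (β * t₁) := Real.one_le_exp (mul_nonneg hβ0 ht₁.1)
  have h3 := hYb t₁ ⟨le_rfl, ht₁.2⟩
  nlinarith

/-- Left-moving characteristics, followed backwards in time, reach `t = 0`. -/
lemma exists_left_moving (h : RiemannSol k a s q) (hk : 0 < k) (hac : Continuous a)
    (ha : ∀ t, 0 ≤ t → 0 ≤ a t) {M : ℝ} (hM : ∀ x, |s x 0| ≤ M) (b : ℝ) {T : ℝ} (hT : 0 ≤ T) :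
    ∃ Y : ℝ → ℝ, Y T = b ∧ ∀ t ∈ Icc 0 T,
      HasDerivWithinAt Y (-((s (Y t) t + q (Y t) t) ^ 2 / (4 * k))) (Icc 0 T) t := by
  obtain ⟨A, hup⟩ := h.exists_sqrt_growth hk hac ha hM b T
  obtain ⟨A', hlow⟩ := h.exists_lower_bound hk ha hM b T
  obtain ⟨C, hC⟩ := h.left_moving_displacement_le hk hac ha hup hlow
  set R := max b (C + 1) with hR
  have hbR : b ≤ R := le_max_left _ _
  obtain ⟨Y, hYT, hY⟩ := exists_clamped_curve h.c1_speed hbR hT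
  have hanti : AntitoneOn Y (Icc 0 T) := by
    have : MonotoneOn (fun t => -Y t) (Icc 0 T) :=
      monotoneOn_Icc_of_hasDerivWithinAt (fun t ht => (hY t ht).neg) fun t _ => by
        rw [neg_neg]; positivity
    intro t ht r hr htr
    exact neg_le_neg_iff.mp (this ht hr htr)
  have hYb : ∀ t ∈ Icc 0 T, b ≤ Y t := fun t ht => by
    rw [← hYT]; exact hanti ht ⟨hT, le_rfl⟩ ht.2
  have htrue : ∀ t ∈ Icc 0 T, Y t ≤ R →
      HasDerivWithinAt Y (-((s (Y t) t + q (Y t) t) ^ 2 / (4 * k))) (Icc 0 T) t := by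
    intro t ht hle
    have := hY t ht
    rwa [min_eq_left hle, max_eq_right (hYb t ht)] at this
  have hYR : Y 0 ≤ R := by
    by_contra! hlt
    have hcont : ContinuousOn Y (Icc 0 T) := fun t ht => (hY t ht).continuousWithinAt
    obtain ⟨t₁, ht₁, hYt₁⟩ := intermediate_value_Icc' hT hcont ⟨hYT ▸ hbR, hlt.le⟩
    have hsub : Icc t₁ T ⊆ Icc 0 T := Icc_subset_Icc_left ht₁.1
    have := hC Y t₁ ht₁ hYT (fun t ht => hYb t (hsub ht)) fun t ht =>
      (htrue t (hsub ht) (hYt₁ ▸ hanti ht₁ (hsub ht) ht.1)).mono hsub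
    linarith [le_max_right b (C + 1)]
  exact ⟨Y, hYT, fun t ht => htrue t ht ((hanti ⟨le_rfl, hT⟩ ht ht.1).trans hYR)⟩

lemma exists_right_moving (h : RiemannSol k a s q) (hk : 0 < k) (hac : Continuous a)
    (ha : ∀ t, 0 ≤ t → 0 ≤ a t) {M : ℝ} (hM : ∀ x, |q x 0| ≤ M) (b : ℝ) {T : ℝ} (hT : 0 ≤ T) :
    ∃ X : ℝ → ℝ, X T = b ∧ ∀ t ∈ Icc 0 T,
      HasDerivWithinAt X ((s (X t) t + q (X t) t) ^ 2 / (4 * k)) (Icc 0 T) t := by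
  obtain ⟨Y, hYT, hY⟩ := h.reflect.exists_left_moving hk hac ha (fun x => hM (-x)) (-b) hT
  refine ⟨fun t => -Y t, by simp [hYT], fun t ht => ?_⟩
  refine (hY t ht).neg.congr_deriv ?_
  rw [neg_neg, add_comm]

end RiemannSol

/-- From a point of the region between `X` and `Y` one can go backwards in time with slope `v ≥ 0`
without leaving the region. -/
lemma exists_backward_curve {X Y : ℝ → ℝ} {v x t : ℝ} (ht : 0 < t) (hv : 0 ≤ v)
    (hX : ContinuousWithinAt X (Iio t) t) (hXd : x = X t → HasDerivWithinAt X v (Iio t) t)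
    (hXY : ∀ r ∈ Ioo 0 t, X r ≤ Y r) (hY : ∀ r ∈ Ioo 0 t, Y t ≤ Y r)
    (hXx : X t ≤ x) (hxY : x ≤ Y t) :
    ∃ Z : ℝ → ℝ, Z t = x ∧ HasDerivWithinAt Z v (Iio t) t ∧
      ∀ᶠ r in 𝓝[<] t, X r ≤ Z r ∧ Z r ≤ Y r := by
  rcases hXx.eq_or_lt with hE | hlt
  · refine ⟨X, hE, hXd hE.symm, ?_⟩
    filter_upwards [Ioo_mem_nhdsLT ht] with r hr using ⟨le_rfl, hXY r hr⟩
  · have hd : HasDerivAt (fun r => x + v * (r - t)) v t := by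
      simpa using (((hasDerivAt_id t).sub_const t).const_mul v).const_add x
    refine ⟨fun r => x + v * (r - t), by simp, hd.hasDerivWithinAt, ?_⟩
    have hlim : ∀ᶠ r in 𝓝[<] t, X r < x + v * (r - t) :=
      hX.eventually_lt hd.continuousAt.continuousWithinAt (by simpa using hlt)
    filter_upwards [hlim, Ioo_mem_nhdsLT ht] with r hr hrt
    refine ⟨hr.le, ?_⟩
    nlinarith [hY r hrt, hrt.2]

lemma hasDerivWithinAt_Iio_of_Icc {X : ℝ → ℝ} {v t T : ℝ} (ht : 0 < t) (htT : t ≤ T)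
    (h : HasDerivWithinAt X v (Icc 0 T) t) : HasDerivWithinAt X v (Iio t) t := by
  refine h.mono_of_mem_nhdsWithin (mem_of_superset (Ioo_mem_nhdsLT ht) fun r hr => ?_)
  exact ⟨hr.1.le, hr.2.le.trans htT⟩

/-- Maximum principle on a characteristic triangle for a diagonal system whose lower order terms
push the two unknowns towards each other. -/
lemma le_of_characteristic_triangle {f g c : ℝ → ℝ → ℝ} {b X Y : ℝ → ℝ} {x₀ T M : ℝ}
    (hT : 0 ≤ T) (hf : C1Half f) (hg : C1Half g) (hb : ∀ t, 0 ≤ t → 0 ≤ b t)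
    (hc : ∀ x t, 0 ≤ t → 0 ≤ c x t)
    (eqf : ∀ x t, 0 ≤ t → pdt f x t + c x t * pdx f x t = -(b t) * (f x t - g x t))
    (eqg : ∀ x t, 0 ≤ t → pdt g x t - c x t * pdx g x t = b t * (f x t - g x t))
    (hXT : X T = x₀) (hX : ∀ t ∈ Icc 0 T, HasDerivWithinAt X (c (X t) t) (Icc 0 T) t)
    (hYT : Y T = x₀) (hY : ∀ t ∈ Icc 0 T, HasDerivWithinAt Y (-(c (Y t) t)) (Icc 0 T) t)
    (f0 : ∀ x, f x 0 ≤ M) (g0 : ∀ x, g x 0 ≤ M) : f x₀ T ≤ M ∧ g x₀ T ≤ M := by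
  have hXm : MonotoneOn X (Icc 0 T) :=
    monotoneOn_Icc_of_hasDerivWithinAt hX fun t ht => hc _ _ ht.1
  have hYm : MonotoneOn (fun t => -Y t) (Icc 0 T) :=
    monotoneOn_Icc_of_hasDerivWithinAt (fun t ht => (hY t ht).neg) fun t ht => by
      rw [neg_neg]; exact hc _ _ ht.1
  have hTm : T ∈ Icc 0 T := ⟨hT, le_rfl⟩
  have h0m : (0 : ℝ) ∈ Icc 0 T := ⟨le_rfl, hT⟩
  have hXY : ∀ t ∈ Icc 0 T, X t ≤ Y t := fun t ht => by
    have h1 := hXm ht hTm ht.2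
    have h2 := hYm ht hTm ht.2
    simp only at h2
    linarith
  set B := Icc (X 0) (Y 0) ×ˢ Icc 0 T with hB
  set D := {p ∈ B | X p.2 ≤ p.1 ∧ p.1 ≤ Y p.2} with hD
  have hXc : ContinuousOn (fun p : ℝ × ℝ => X p.2) B :=
    ContinuousOn.comp (t := Icc 0 T) (fun t ht => (hX t ht).continuousWithinAt)
      continuousOn_snd fun p hp => hp.2
  have hYc : ContinuousOn (fun p : ℝ × ℝ => Y p.2) B :=
    ContinuousOn.comp (t := Icc 0 T) (fun t ht => (hY t ht).continuousWithinAt)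
      continuousOn_snd fun p hp => hp.2
  have hBc : IsCompact B := isCompact_Icc.prod isCompact_Icc
  have hDc : IsCompact D := by
    refine hBc.of_isClosed_subset ?_ fun p hp => hp.1
    have e : D = {p ∈ B | X p.2 ≤ p.1} ∩ {p ∈ B | p.1 ≤ Y p.2} := by
      ext p; simp only [hD, mem_ofPred_eq, mem_inter_iff]; tauto
    rw [e]
    exact (hBc.isClosed.isClosed_le hXc continuousOn_fst).inter
      (hBc.isClosed.isClosed_le continuousOn_fst hYc)
  have hDmem : ∀ x, ∀ t ∈ Icc 0 T, X t ≤ x → x ≤ Y t → (x, t) ∈ D := by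
    intro x t ht h1 h2
    have h3 := hXm h0m ht ht.1
    have h4 := hYm h0m ht ht.1
    simp only at h4
    exact ⟨⟨⟨by simpa using h3.trans h1, by simp only; linarith⟩, ht⟩, h1, h2⟩
  have key : ∀ ε > 0, max (f x₀ T) (g x₀ T) - ε * T ≤ M := by
    intro ε hε
    have hsub : D ⊆ {p : ℝ × ℝ | 0 ≤ p.2} := fun p hp => hp.1.2.1
    have hcont : ContinuousOn (fun p : ℝ × ℝ => max (f p.1 p.2) (g p.1 p.2) - ε * p.2) D :=
      ((hf.continuousOn.mono hsub).sup (hg.continuousOn.mono hsub)).sub (by fun_prop)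
    have hmem₀ : (x₀, T) ∈ D := hDmem x₀ T hTm hXT.le hYT.ge
    obtain ⟨⟨x, t⟩, hp, hmax⟩ := hDc.exists_isMaxOn ⟨_, hmem₀⟩ hcont
    have ht : t ∈ Icc 0 T := hp.1.2
    have hXx : X t ≤ x := hp.2.1
    have hxY : x ≤ Y t := hp.2.2
    have hmax' : ∀ y, ∀ r ∈ Icc 0 T, X r ≤ y → y ≤ Y r →
        max (f y r) (g y r) - ε * r ≤ max (f x t) (g x t) - ε * t :=
      fun y r hr h1 h2 => hmax (hDmem y r hr h1 h2)
    refine (hmax' x₀ T hTm hXT.le hYT.ge).trans ?_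
    rcases ht.1.eq_or_lt with h0 | htpos
    · subst h0
      simpa using ⟨f0 x, g0 x⟩
    exfalso
    have hIoo : ∀ r ∈ Ioo 0 t, r ∈ Icc 0 T := fun r hr => ⟨hr.1.le, hr.2.le.trans ht.2⟩
    have hXd := hasDerivWithinAt_Iio_of_Icc htpos ht.2 (hX t ht)
    have hYd := hasDerivWithinAt_Iio_of_Icc htpos ht.2 (hY t ht)
    have hεd : HasDerivWithinAt (fun r => ε * r) ε (Iio t) t := by
      simpa using ((hasDerivAt_id t).const_mul ε).hasDerivWithinAt (s := Iio t)
    rcases le_total (g x t) (f x t) with hle | hle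
    · obtain ⟨Z, hZt, hZd, hZ⟩ := exists_backward_curve (x := x) (v := c x t) htpos (hc x t ht.1)
        hXd.continuousWithinAt (fun h => h ▸ hXd) (fun r hr => hXY r (hIoo r hr))
        (fun r hr => neg_le_neg_iff.mp (hYm (hIoo r hr) ht hr.2.le)) hXx hxY
      have hd := (hf.hasDerivWithinAt_comp ht.1 hZd).sub hεd
      have := nonneg_of_hasDerivWithinAt_Iio_of_le hd (by
        filter_upwards [hZ, Ioo_mem_nhdsLT htpos] with r hr hrt
        have := hmax' (Z r) r (hIoo r hrt) hr.1 hr.2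
        rw [max_eq_left hle] at this
        simp only [Pi.sub_apply, hZt]
        exact (sub_le_sub_right (le_max_left _ _) _).trans this)
      rw [hZt, eqf x t ht.1] at this
      nlinarith [hb t ht.1]
    · obtain ⟨Z, hZt, hZd, hZ⟩ := exists_backward_curve (X := fun r => -Y r) (Y := fun r => -X r)
        (x := -x) (v := c x t) htpos (hc x t ht.1) hYd.neg.continuousWithinAt
        (fun h => by rw [neg_inj] at h; simpa [← h] using hYd.fun_neg)
        (fun r hr => neg_le_neg (hXY r (hIoo r hr)))
        (fun r hr => neg_le_neg (hXm (hIoo r hr) ht hr.2.le)) (neg_le_neg hxY) (neg_le_neg hXx)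
      have hd := (hg.hasDerivWithinAt_comp ht.1 hZd.neg).sub hεd
      have hZt' : (-Z) t = x := by simp [hZt]
      have := nonneg_of_hasDerivWithinAt_Iio_of_le hd (by
        filter_upwards [hZ, Ioo_mem_nhdsLT htpos] with r hr hrt
        have := hmax' ((-Z) r) r (hIoo r hrt) (le_neg.mpr hr.2) (neg_le.mpr hr.1)
        rw [max_eq_right hle] at this
        simp only [Pi.sub_apply, hZt']
        exact (sub_le_sub_right (le_max_right _ _) _).trans this)
      rw [hZt', neg_mul, ← sub_eq_add_neg, eqg x t ht.1] at this
      nlinarith [hb t ht.1]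
  rw [← max_le_iff]
  refine le_of_forall_pos_le_add fun δ hδ => ?_
  have h1 := key (δ / (T + 1)) (by positivity)
  have h2 : δ / (T + 1) * T ≤ δ := by
    rw [div_mul_eq_mul_div, div_le_iff₀ (by positivity)]
    nlinarith
  linarith

namespace RiemannSol

variable {k : ℝ} {a : ℝ → ℝ} {s q : ℝ → ℝ → ℝ}

lemma abs_le_of_initial (h : RiemannSol k a s q) (hk : 0 < k) (hac : Continuous a)
    (ha : ∀ t, 0 ≤ t → 0 ≤ a t) {M : ℝ} (hs : ∀ x, |s x 0| ≤ M) (hq : ∀ x, |q x 0| ≤ M)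
    (x : ℝ) {t : ℝ} (ht : 0 ≤ t) : |s x t| ≤ M ∧ |q x t| ≤ M := by
  obtain ⟨X, hXT, hX⟩ := h.exists_right_moving hk hac ha hq x ht
  obtain ⟨Y, hYT, hY⟩ := h.exists_left_moving hk hac ha hs x ht
  have hc : ∀ x t, 0 ≤ t → 0 ≤ (s x t + q x t) ^ 2 / (4 * k) := fun _ _ _ => by positivity
  have hb : ∀ t, 0 ≤ t → 0 ≤ a t / 2 := fun t ht => by linarith [ha t ht]
  have up := le_of_characteristic_triangle ht h.c1s h.c1q hb hc h.eqs h.eqq hXT hX hYT hY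
    (fun x => (abs_le.mp (hs x)).2) (fun x => (abs_le.mp (hq x)).2)
  have e1 : ∀ x t, pdt (fun x t => -s x t) x t = -pdt s x t := fun _ _ => deriv.fun_neg
  have e2 : ∀ x t, pdx (fun x t => -s x t) x t = -pdx s x t := fun _ _ => deriv.fun_neg
  have e3 : ∀ x t, pdt (fun x t => -q x t) x t = -pdt q x t := fun _ _ => deriv.fun_neg
  have e4 : ∀ x t, pdx (fun x t => -q x t) x t = -pdx q x t := fun _ _ => deriv.fun_neg
  have low := le_of_characteristic_triangle (f := fun x t => -s x t) (g := fun x t => -q x t)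
    (M := M) ht (fun x t ht => (h.c1s x t ht).neg) (fun x t ht => (h.c1q x t ht).neg) hb hc
    (fun x t ht => by rw [e1, e2]; linarith [h.eqs x t ht])
    (fun x t ht => by rw [e3, e4]; linarith [h.eqq x t ht]) hXT hX hYT hY
    (fun x => by linarith [(abs_le.mp (hs x)).1]) (fun x => by linarith [(abs_le.mp (hq x)).1])
  exact ⟨abs_le.mpr ⟨by linarith [low.1], up.1⟩, abs_le.mpr ⟨by linarith [low.2], up.2⟩⟩

end RiemannSol

namespace RiemannSol

variable {k α μ : ℝ} {s q : ℝ → ℝ → ℝ}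

lemma continuous_damping (α : ℝ) (hμ : 0 ≤ μ) : Continuous fun t : ℝ => α * (1 + t) ^ μ :=
  continuous_const.mul ((Real.continuous_rpow_const hμ).comp (continuous_const.add continuous_id))

lemma c1_source (h : RiemannSol k (fun t => α * (1 + t) ^ μ) s q) :
    C1Half (fun x t => -(α * (1 + t) ^ μ / 2) * (s x t - q x t)) := by
  intro x t ht
  have h1 := h.c1s x t ht
  have h2 := h.c1q x t ht
  have h3 : ContDiffAt ℝ 1 (fun p : ℝ × ℝ => (1 + p.2) ^ μ) (x, t) :=
    ContDiffAt.rpow_const_of_ne (by fun_prop) (by simp only; positivity)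
  fun_prop

lemma pdx_source {a : ℝ → ℝ} (h : RiemannSol k a s q) {x t : ℝ} (ht : 0 ≤ t) :
    pdx (fun x t => -(a t / 2) * (s x t - q x t)) x t
      = -(a t / 2) * (pdx s x t - pdx q x t) :=
  (((h.c1s.hasDerivAt_x ht).sub (h.c1q.hasDerivAt_x ht)).const_mul _).deriv

lemma hasDerivAt_half_sum {a X : ℝ → ℝ} {t : ℝ} (h : RiemannSol k a s q) (hk : 0 < k)
    (ht : 0 ≤ t) (hX : HasDerivAt X ((s (X t) t + q (X t) t) ^ 2 / (4 * k)) t) :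
    HasDerivAt (fun r => (s (X r) r + q (X r) r) / 2)
      (((s (X t) t + q (X t) t) / 2) ^ 2 * pdx q (X t) t / k) t := by
  have d1 := (h.c1s.hasDerivWithinAt_comp (S := univ) ht hX.hasDerivWithinAt).hasDerivAt univ_mem
  have d2 := (h.c1q.hasDerivWithinAt_comp (S := univ) ht hX.hasDerivWithinAt).hasDerivAt univ_mem
  refine ((d1.add d2).div_const 2).congr_deriv ?_
  have e1 := h.eqs (X t) t ht
  have e2 := h.eqq (X t) t ht
  have e3 : ((s (X t) t + q (X t) t) / 2) ^ 2 * pdx q (X t) t / k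
      = (s (X t) t + q (X t) t) ^ 2 / (4 * k) * pdx q (X t) t := by field_simp; ring
  rw [e3]
  linear_combination e1 / 2 + e2 / 2

lemma continuousOn_pdx_curve {F : ℝ → ℝ → ℝ} (hF : C1Half F) {X : ℝ → ℝ} {T : ℝ}
    (hX : ContinuousOn X (Icc 0 T)) : ContinuousOn (fun t => pdx F (X t) t) (Icc 0 T) :=
  hF.continuousOn_pdx.comp (f := fun t => (X t, t)) (hX.prodMk continuousOn_id) fun _ ht => ht.1

lemma continuousOn_curve {F : ℝ → ℝ → ℝ} (hF : C1Half F) {X : ℝ → ℝ} {T : ℝ}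
    (hX : ContinuousOn X (Icc 0 T)) : ContinuousOn (fun t => F (X t) t) (Icc 0 T) :=
  hF.continuousOn.comp (f := fun t => (X t, t)) (hX.prodMk continuousOn_id) fun _ ht => ht.1

/-- One-sided bound for the weighted gradient `φ s_x`, obtained by integrating the Riccati equation
satisfied by `φ s_x / p - (α k / 2) log φ` along right-moving characteristics, `p = (1 + t) ^ μ`. -/
lemma gradient_le (h : RiemannSol k (fun t => α * (1 + t) ^ μ) s q) (hk : 0 < k) (hα : 0 ≤ α)
    (hμ : 0 < μ) {M m G : ℝ} (hs : ∀ x, |s x 0| ≤ M) (hq : ∀ x, |q x 0| ≤ M) (hm : 0 < m)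
    (hφ : ∀ x, m ≤ (s x 0 + q x 0) / 2) (hG : ∀ x, (s x 0 + q x 0) / 2 * pdx s x 0 ≤ G)
    (x : ℝ) {T : ℝ} (hT : 0 ≤ T) :
    (s x T + q x T) / 2 * pdx s x T
      ≤ (1 + T) ^ μ * (G - α * k / 2 * log m + α * k / 2 * log M
          + k / 4 * (α / 2 + μ) ^ 2 * (1 + T) ^ μ * T) := by
  have hac := continuous_damping α hμ.le
  have ha : ∀ t : ℝ, 0 ≤ t → 0 ≤ α * (1 + t) ^ μ := fun t ht => by positivity
  obtain ⟨X, hXT, hX⟩ := h.exists_right_moving hk hac ha hq x hT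
  have hXc : ContinuousOn X (Icc 0 T) := fun t ht => (hX t ht).continuousWithinAt
  have hXd : ∀ t ∈ Ioo 0 T, HasDerivAt X ((s (X t) t + q (X t) t) ^ 2 / (4 * k)) t := fun t ht =>
    (hX t ⟨ht.1.le, ht.2.le⟩).hasDerivAt (Icc_mem_nhds ht.1 ht.2)
  set φ : ℝ → ℝ := fun t => (s (X t) t + q (X t) t) / 2 with hφdef
  have hφpos : ∀ t, 0 ≤ t → 0 < φ t := fun t ht => half_pos (h.pos _ _ ht)
  set C := k / 4 * (α / 2 + μ) ^ 2 with hC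
  set W : ℝ → ℝ := fun t => φ t * pdx s (X t) t / (1 + t) ^ μ - α * k / 2 * log (φ t)
    - C * (1 + T) ^ μ * t with hW
  have hanti : AntitoneOn W (Icc 0 T) := by
    refine antitoneOn_of_hasDerivWithinAt_nonpos (convex_Icc _ _)
      (f' := fun t => -(φ t * pdx s (X t) t) ^ 2 / (k * (1 + t) ^ μ)
        - (α / 2 + μ / ((1 + t) * (1 + t) ^ μ)) * (φ t * pdx s (X t) t) - C * (1 + T) ^ μ) ?_ ?_ ?_
    · have hφc : ContinuousOn φ (Icc 0 T) :=
        ((continuousOn_curve h.c1s hXc).add (continuousOn_curve h.c1q hXc)).div_const 2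
      have hpc : ContinuousOn (fun t : ℝ => (1 + t) ^ μ) (Icc 0 T) :=
        ((Real.continuous_rpow_const hμ.le).comp (continuous_const.add continuous_id)).continuousOn
      refine ((ContinuousOn.div (hφc.mul (continuousOn_pdx_curve h.c1s hXc)) hpc fun t ht => ?_).sub
        (continuousOn_const.mul (hφc.log fun t ht => (hφpos t ht.1).ne'))).sub (by fun_prop)
      have := ht.1
      positivity
    · intro t ht
      rw [interior_Icc] at ht
      have ht0 := ht.1.le
      have dφ := h.hasDerivAt_half_sum hk ht0 (hXd t ht)
      have dS := C1Half.hasDerivAt_pdx_characteristic h.c1s h.c1_speed h.c1_source h.eqs hXd ht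
      rw [h.pdx_speed ht0, h.pdx_source ht0] at dS
      have dp : HasDerivAt (fun t : ℝ => (1 + t) ^ μ) (1 * μ * (1 + t) ^ (μ - 1)) t :=
        ((hasDerivAt_id t).const_add 1).rpow_const (Or.inl (by simp only [id]; positivity))
      have hp0 : (1 + t) ^ μ ≠ 0 := by positivity
      have dW := (((dφ.mul dS).div dp hp0).sub ((dφ.log (hφpos t ht0).ne').const_mul
        (α * k / 2))).sub ((hasDerivAt_id t).const_mul (C * (1 + T) ^ μ))
      refine (dW.congr_deriv ?_).hasDerivWithinAt
      have hφ0 := (hφpos t ht0).ne'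
      have e1 : (1 + t) ^ (μ - 1) = (1 + t) ^ μ / (1 + t) := by
        rw [Real.rpow_sub_one (by positivity)]
      have e2 : s (X t) t + q (X t) t = 2 * φ t := by simp only [hφdef]; ring
      have ht1 : (1 + t) ≠ 0 := by positivity
      simp only [Pi.mul_apply, e1, e2]
      rw [show 2 * φ t / 2 = φ t by ring]
      field_simp
      ring
    · intro t ht
      rw [interior_Icc] at ht
      have ht0 := ht.1.le
      set y := φ t * pdx s (X t) t
      set p := (1 + t) ^ μ with hp
      have hp1 : 1 ≤ p := Real.one_le_rpow (by linarith) hμ.le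
      have hpT : p ≤ (1 + T) ^ μ := Real.rpow_le_rpow (by linarith) (by linarith [ht.2]) hμ.le
      set β := α / 2 + μ / ((1 + t) * p) with hβ
      have hβ0 : 0 ≤ β := by positivity
      have hβ1 : β ≤ α / 2 + μ := by
        have : μ / ((1 + t) * p) ≤ μ := div_le_self hμ.le (by nlinarith)
        linarith
      have e : -y ^ 2 / (k * p) - β * y = k * p * β ^ 2 / 4 - (y + k * p * β / 2) ^ 2 / (k * p) := by
        field_simp; ring
      have h1 : 0 ≤ (y + k * p * β / 2) ^ 2 / (k * p) := by positivity
      have h2 : k * p * β ^ 2 / 4 ≤ C * (1 + T) ^ μ := by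
        have : k * p * β ^ 2 / 4 = k / 4 * β ^ 2 * p := by ring
        rw [this, hC]
        gcongr
      linarith
  have hend := hanti ⟨le_rfl, hT⟩ ⟨hT, le_rfl⟩ hT
  have hb := h.abs_le_of_initial hk hac ha hs hq x hT
  simp only [hW, hφdef, hXT, add_zero, Real.one_rpow, div_one, mul_zero, sub_zero] at hend
  have hφM : (s x T + q x T) / 2 ≤ M := by
    linarith [(abs_le.mp hb.1).2, (abs_le.mp hb.2).2]
  have hφT : 0 < (s x T + q x T) / 2 := half_pos (h.pos x T hT)
  have hαk : 0 ≤ α * k / 2 := by positivity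
  have l1 := mul_le_mul_of_nonneg_left (Real.log_le_log hm (hφ (X 0))) hαk
  have l2 := mul_le_mul_of_nonneg_left (Real.log_le_log hφT hφM) hαk
  have hp : 0 < (1 + T) ^ μ := by positivity
  rw [← div_le_iff₀' hp]
  linarith [hG (X 0)]

/-- Exponential lower bound for `φ = (s + q) / 2`. -/
lemma half_sum_ge (h : RiemannSol k (fun t => α * (1 + t) ^ μ) s q) (hk : 0 < k) (hα : 0 ≤ α)
    (hμ : 0 < μ) {M m G : ℝ} (hs : ∀ x, |s x 0| ≤ M) (hq : ∀ x, |q x 0| ≤ M) (hm : 0 < m)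
    (hφ : ∀ x, m ≤ (s x 0 + q x 0) / 2) (hGs : ∀ x, (s x 0 + q x 0) / 2 * pdx s x 0 ≤ G)
    (hGq : ∀ x, (s x 0 + q x 0) / 2 * -pdx q x 0 ≤ G) {E : ℝ}
    (hE : |G - α * k / 2 * log m + α * k / 2 * log M| + k / 4 * (α / 2 + μ) ^ 2 ≤ E)
    (x : ℝ) {T : ℝ} (hT : 0 ≤ T) :
    m * exp (-(E / k * T * ((1 + T) ^ μ * ((1 + T) ^ μ * (1 + T))))) ≤ (s x T + q x T) / 2 := by
  set A := G - α * k / 2 * log m + α * k / 2 * log M with hA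
  set C := k / 4 * (α / 2 + μ) ^ 2 with hC
  have hC0 : 0 ≤ C := by positivity
  set N := E * ((1 + T) ^ μ * ((1 + T) ^ μ * (1 + T))) with hN
  have hbound : ∀ t ∈ Icc 0 T, (1 + t) ^ μ * (A + C * (1 + t) ^ μ * t) ≤ N := by
    intro t ht
    have ht0 := ht.1
    have hpT : (1 + t) ^ μ ≤ (1 + T) ^ μ :=
      Real.rpow_le_rpow (by linarith) (by linarith [ht.2]) hμ.le
    have hp1 : 1 ≤ (1 + t) ^ μ := Real.one_le_rpow (by linarith) hμ.le
    have h1 : A + C * (1 + t) ^ μ * t ≤ E * ((1 + T) ^ μ * (1 + T)) := by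
      have h2 : (1 + t) ^ μ * (1 + t) ≤ (1 + T) ^ μ * (1 + T) := by
        have := ht.2
        gcongr
      have h3 : A + C * (1 + t) ^ μ * t ≤ (|A| + C) * ((1 + t) ^ μ * (1 + t)) := by
        have h4 : 1 ≤ (1 + t) ^ μ * (1 + t) := by nlinarith
        have h5 := le_abs_self A
        have h6 := mul_le_mul_of_nonneg_left h4 (abs_nonneg A)
        have h7 : 0 ≤ C * (1 + t) ^ μ := by positivity
        linarith
      have h8 : 0 ≤ |A| + C := by positivity
      exact h3.trans (mul_le_mul hE h2 (by positivity) (h8.trans hE))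
    calc (1 + t) ^ μ * (A + C * (1 + t) ^ μ * t)
        ≤ (1 + t) ^ μ * (E * ((1 + T) ^ μ * (1 + T))) := by gcongr
      _ ≤ (1 + T) ^ μ * (E * ((1 + T) ^ μ * (1 + T))) := by
          have : 0 ≤ E := le_trans (by positivity) hE
          gcongr
      _ = N := by rw [hN]; ring
  have hs_le : ∀ t ∈ Icc 0 T, (s x t + q x t) / 2 * pdx s x t ≤ N := fun t ht =>
    (h.gradient_le hk hα hμ hs hq hm hφ hGs x ht.1).trans (hbound t ht)
  have hq_le : ∀ t ∈ Icc 0 T, (s x t + q x t) / 2 * -pdx q x t ≤ N := by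
    intro t ht
    have := h.reflect.gradient_le hk hα hμ (G := G) (fun x => hq (-x)) (fun x => hs (-x)) hm
      (fun x => by rw [add_comm]; exact hφ (-x))
      (fun x => by rw [pdx_reflect, add_comm]; exact hGq (-x)) (-x) ht.1
    rw [pdx_reflect, neg_neg, add_comm (q x t)] at this
    exact this.trans (hbound t ht)
  have hmono : MonotoneOn (fun t => (s x t + q x t) / 2 * exp (N / k * t)) (Icc 0 T) := by
    refine monotoneOn_Icc_of_hasDerivWithinAt
      (f' := fun t => ((pdt s x t + pdt q x t) / 2 + (s x t + q x t) / 2 * (N / k))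
        * exp (N / k * t)) (fun t ht => ?_) fun t ht => ?_
    · have d : HasDerivAt (fun t => exp (N / k * t)) (exp (N / k * t) * (N / k * 1)) t :=
        ((hasDerivAt_id t).const_mul (N / k)).exp
      refine (((((h.c1s.hasDerivAt_t ht.1).add (h.c1q.hasDerivAt_t ht.1)).div_const 2).mul
        d).congr_deriv ?_).hasDerivWithinAt
      simp only [Pi.add_apply]
      ring
    · refine mul_nonneg ?_ (exp_pos _).le
      have e1 := h.eqs x t ht.1
      have e2 := h.eqq x t ht.1
      have e : (pdt s x t + pdt q x t) / 2 + (s x t + q x t) / 2 * (N / k)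
          = (s x t + q x t) / 2 * ((N - (s x t + q x t) / 2 * pdx s x t)
            + (N - (s x t + q x t) / 2 * -pdx q x t)) / (2 * k) := by
        field_simp
        field_simp at e1 e2
        linear_combination (e1 + e2) / 2
      rw [e]
      have h1 := hs_le t ht
      have h2 := hq_le t ht
      have h3 := half_pos (h.pos x t ht.1)
      have h4 : 0 ≤ (N - (s x t + q x t) / 2 * pdx s x t)
            + (N - (s x t + q x t) / 2 * -pdx q x t) := by linarith
      positivity
  have hend := hmono ⟨le_rfl, hT⟩ ⟨hT, le_rfl⟩ hT
  simp only [mul_zero, Real.exp_zero, mul_one] at hend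
  have e : E / k * T * ((1 + T) ^ μ * ((1 + T) ^ μ * (1 + T))) = N / k * T := by rw [hN]; ring
  rw [e, Real.exp_neg, ← div_eq_mul_inv, div_le_iff₀ (exp_pos _)]
  exact (hφ x).trans hend

end RiemannSol

lemma ContDiff.c1Half {F : ℝ → ℝ → ℝ} (hF : ContDiff ℝ 1 (fun p : ℝ × ℝ => F p.1 p.2)) :
    C1Half F := fun _ _ _ => hF.contDiffAt

namespace IsSol

variable {K α lam : ℝ} {τ u : ℝ → ℝ → ℝ}

lemma pdx_pressure (h : IsSol K 3 α lam τ u) {x t : ℝ} (ht : 0 ≤ t) :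
    pdx (fun y r => K * τ y r ^ (-(3 : ℝ))) x t = -(3 * K * pdx τ x t / τ x t ^ 4) := by
  have hd := h.1.c1Half.hasDerivAt_x (x := x) ht
  have hpos := h.2.2.1 x t ht
  refine ((hd.rpow_const (p := -(3 : ℝ)) (Or.inl hpos.ne')).const_mul K).deriv.trans ?_
  have e : τ x t ^ (-(3 : ℝ) - 1) = (τ x t ^ 4)⁻¹ := by
    rw [show -(3 : ℝ) - 1 = -((4 : ℕ) : ℝ) by norm_num, Real.rpow_neg hpos.le, Real.rpow_natCast]
  rw [e]
  field_simp

lemma hasDerivAt_mul_inv {f : ℝ → ℝ} {f' y : ℝ} (k : ℝ) (hf : HasDerivAt f f' y) (h0 : f y ≠ 0) :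
    HasDerivAt (fun y => k * (f y)⁻¹) (-(k * f' / f y ^ 2)) y :=
  ((hf.fun_inv h0).const_mul k).congr_deriv (by ring)

lemma riemannSol (h : IsSol K 3 α lam τ u) (hK : 0 < K) :
    RiemannSol (√(3 * K)) (fun t => α * (1 + t) ^ (-lam))
      (fun x t => u x t + √(3 * K) * (τ x t)⁻¹) (fun x t => √(3 * K) * (τ x t)⁻¹ - u x t) := by
  have hτ1 : C1Half τ := h.1.c1Half
  have hu1 : C1Half u := h.2.1.c1Half
  have hpos := h.2.2.1
  set k := √(3 * K) with hk_def
  have hk : 0 < k := Real.sqrt_pos.mpr (by positivity)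
  have hk2 : k ^ 2 = 3 * K := Real.sq_sqrt (by positivity)
  have hmass := h.2.2.2.1
  have hmom : ∀ x t, 0 ≤ t →
      pdt u x t = k ^ 2 * pdx τ x t / τ x t ^ 4 - α * (1 + t) ^ (-lam) * u x t := by
    intro x t ht
    have h1 := h.2.2.2.2 x t ht
    rw [h.pdx_pressure ht, div_eq_mul_inv α, ← Real.rpow_neg (by positivity)] at h1
    rw [hk2]
    linarith
  have dx : ∀ x t, 0 ≤ t → HasDerivAt (fun y => k * (τ y t)⁻¹) (-(k * pdx τ x t / τ x t ^ 2)) x :=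
    fun x t ht => hasDerivAt_mul_inv k (hτ1.hasDerivAt_x ht) (hpos x t ht).ne'
  have dt : ∀ x t, 0 ≤ t → HasDerivAt (fun r => k * (τ x r)⁻¹) (-(k * pdx u x t / τ x t ^ 2)) t :=
    fun x t ht => by
      rw [← hmass x t ht]
      exact hasDerivAt_mul_inv k (hτ1.hasDerivAt_t ht) (hpos x t ht).ne'
  refine ⟨fun x t ht => ?_, fun x t ht => ?_, fun x t ht => ?_, fun x t ht => ?_, fun x t ht => ?_⟩
  · exact (hu1 x t ht).add (contDiffAt_const.mul ((hτ1 x t ht).inv (hpos x t ht).ne'))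
  · exact (contDiffAt_const.mul ((hτ1 x t ht).inv (hpos x t ht).ne')).sub (hu1 x t ht)
  · have := hpos x t ht
    have : 0 < k * (τ x t)⁻¹ := by positivity
    linarith
  · have e1 : pdt (fun x t => u x t + k * (τ x t)⁻¹) x t = _ :=
      ((hu1.hasDerivAt_t ht).add (dt x t ht)).deriv
    have e2 : pdx (fun x t => u x t + k * (τ x t)⁻¹) x t = _ :=
      ((hu1.hasDerivAt_x ht).add (dx x t ht)).deriv
    have := (hpos x t ht).ne'
    rw [e1, e2, hmom x t ht]
    field_simp
    ring
  · have e1 : pdt (fun x t => k * (τ x t)⁻¹ - u x t) x t = _ :=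
      ((dt x t ht).sub (hu1.hasDerivAt_t ht)).deriv
    have e2 : pdx (fun x t => k * (τ x t)⁻¹ - u x t) x t = _ :=
      ((dx x t ht).sub (hu1.hasDerivAt_x ht)).deriv
    have := (hpos x t ht).ne'
    rw [e1, e2, hmom x t ht]
    field_simp
    ring

end IsSol

lemma rpow_mul_rpow_mul_le_exp {lam t : ℝ} (hlam : lam < 0) (ht : 0 ≤ t) :
    (1 + t) ^ (-lam) * ((1 + t) ^ (-lam) * (1 + t))
      ≤ 2 / (-lam / (1 - lam)) ^ 2 * exp (-lam * (1 + t) ^ (1 - lam) / (1 - lam)) := by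
  set p := (1 + t) ^ (-lam) with hp
  have hp0 : 0 < p := by positivity
  have e : (1 + t) ^ (1 - lam) = p * (1 + t) := by
    rw [sub_eq_neg_add, Real.rpow_add_one (by positivity)]
  set κ := -lam / (1 - lam) with hκ
  have hκ0 : 0 < κ := div_pos (by linarith) (by linarith)
  have hv : 0 ≤ κ * (p * (1 + t)) := by positivity
  have h1 := Real.quadratic_le_exp_of_nonneg hv
  have e2 : -lam * (1 + t) ^ (1 - lam) / (1 - lam) = κ * (p * (1 + t)) := by
    rw [e, hκ]; ring
  rw [e2, div_mul_eq_mul_div, le_div_iff₀ (by positivity)]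
  have h2 : p * (p * (1 + t)) * κ ^ 2 ≤ (κ * (p * (1 + t))) ^ 2 := by
    have : (κ * (p * (1 + t))) ^ 2 = p * (p * (1 + t)) * κ ^ 2 * (1 + t) := by ring
    rw [this]
    exact le_mul_of_one_le_right (by positivity) (by linarith)
  linarith

theorem stmt7 (K γ α lam C₀ : ℝ) (hK : 0 < K) (hγ : γ = 3)
    (hα : 0 ≤ α) (hlam : lam < 0) (hC₀ : 0 < C₀) :
    ∃ Mhat > (0 : ℝ),
      ∀ (τ₀ u₀ : ℝ → ℝ), ContDiff ℝ 1 τ₀ → ContDiff ℝ 1 u₀ →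
        (∀ x, |u₀ x| ≤ C₀ ∧ |deriv u₀ x| ≤ C₀) →
        (∀ x, |τ₀ x| ≤ C₀ ∧ |deriv τ₀ x| ≤ C₀) →
        (∀ x, C₀⁻¹ < τ₀ x) →
      ∀ (τ u : ℝ → ℝ → ℝ), IsSol K γ α lam τ u →
        (∀ x, τ x 0 = τ₀ x ∧ u x 0 = u₀ x) →
        (∃ U : ℝ, ∀ x t, 0 ≤ t → |u x t| ≤ U) ∧
        (∀ x t, 0 ≤ t →
          C₀⁻¹ * Real.exp (-(Mhat * t * Real.exp (-lam * (1 + t) ^ (1 - lam) / (1 - lam))))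
            ≤ (τ x t)⁻¹) := by
  subst hγ
  set k := √(3 * K) with hk_def
  have hk : 0 < k := Real.sqrt_pos.mpr (by positivity)
  set M := C₀ + k * C₀ with hM
  set m := k * C₀⁻¹ with hm
  set G := k * C₀ * (C₀ + k * C₀ ^ 3) with hG
  set E := |G - α * k / 2 * log m + α * k / 2 * log M| + k / 4 * (α / 2 + -lam) ^ 2 with hE
  have hE0 : 0 ≤ E := by positivity
  set B := 2 / (-lam / (1 - lam)) ^ 2 with hB
  have hB0 : 0 < B := by
    have : 0 < -lam / (1 - lam) := div_pos (by linarith) (by linarith)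
    positivity
  refine ⟨(E + 1) / k * B, by positivity, ?_⟩
  intro τ₀ u₀ _ _ hu₀ hτ₀ hτlow τ u hsol hinit
  have hR := hsol.riemannSol hK
  have eτ : (fun y => τ y 0) = τ₀ := funext fun y => (hinit y).1
  have eu : (fun y => u y 0) = u₀ := funext fun y => (hinit y).2
  have hτ₀pos : ∀ x, 0 < τ₀ x := fun x => lt_trans (by positivity) (hτlow x)
  have hτinv : ∀ x, (τ₀ x)⁻¹ ≤ C₀ := fun x => (inv_lt_of_inv_lt₀ hC₀ (hτlow x)).le
  have hφ_le : ∀ x, k * (τ x 0)⁻¹ ≤ k * C₀ := fun x => by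
    rw [(hinit x).1]
    exact mul_le_mul_of_nonneg_left (hτinv x) hk.le
  have hφ_pos : ∀ x t, 0 ≤ t → 0 < k * (τ x t)⁻¹ := fun x t ht =>
    mul_pos hk (inv_pos.mpr (hsol.2.2.1 x t ht))
  have hu_abs : ∀ x, |u x 0| ≤ C₀ := fun x => by
    rw [(hinit x).2]
    exact (hu₀ x).1
  have hs0 : ∀ x, |u x 0 + k * (τ x 0)⁻¹| ≤ M := fun x => by
    refine (abs_add_le _ _).trans ?_
    rw [abs_of_pos (hφ_pos x 0 le_rfl)]
    exact add_le_add (hu_abs x) (hφ_le x)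
  have hq0 : ∀ x, |k * (τ x 0)⁻¹ - u x 0| ≤ M := fun x => by
    refine (abs_sub _ _).trans ?_
    rw [abs_of_pos (hφ_pos x 0 le_rfl), add_comm]
    exact add_le_add (hu_abs x) (hφ_le x)
  have hφx : ∀ x, HasDerivAt (fun y => k * (τ y 0)⁻¹) (-(k * deriv τ₀ x / τ₀ x ^ 2)) x := by
    intro x
    have h1 := hsol.1.c1Half.hasDerivAt_x (x := x) le_rfl
    have h2 := IsSol.hasDerivAt_mul_inv k h1 (hsol.2.2.1 x 0 le_rfl).ne'
    rwa [pdx, eτ, (hinit x).1] at h2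
  have hux : ∀ x, HasDerivAt (fun y => u y 0) (deriv u₀ x) x := by
    intro x
    have h1 := hsol.2.1.c1Half.hasDerivAt_x (x := x) le_rfl
    rw [pdx, eu] at h1
    rwa [eu]
  have hφx_abs : ∀ x, |k * deriv τ₀ x / τ₀ x ^ 2| ≤ k * C₀ ^ 3 := by
    intro x
    rw [abs_div, abs_mul, abs_of_pos hk, abs_of_pos (pow_pos (hτ₀pos x) 2), div_eq_mul_inv,
      ← inv_pow, mul_assoc]
    have h1 := (hτ₀ x).2
    have h2 : (τ₀ x)⁻¹ ^ 2 ≤ C₀ ^ 2 := pow_le_pow_left₀ (inv_pos.mpr (hτ₀pos x)).le (hτinv x) 2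
    calc k * (|deriv τ₀ x| * (τ₀ x)⁻¹ ^ 2) ≤ k * (C₀ * C₀ ^ 2) := by gcongr
      _ = k * C₀ ^ 3 := by ring
  have hhalf : ∀ x t, (u x t + k * (τ x t)⁻¹ + (k * (τ x t)⁻¹ - u x t)) / 2 = k * (τ x t)⁻¹ :=
    fun x t => by ring
  have hgrad : ∀ x y, |y| ≤ C₀ + k * C₀ ^ 3 → k * (τ x 0)⁻¹ * y ≤ G := fun x y hy =>
    (mul_le_mul_of_nonneg_left ((le_abs_self y).trans hy) (hφ_pos x 0 le_rfl).le).trans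
      (mul_le_mul_of_nonneg_right (hφ_le x) (by positivity))
  have hac := RiemannSol.continuous_damping α (neg_nonneg.mpr hlam.le)
  refine ⟨⟨M, fun x t ht => ?_⟩, fun x t ht => ?_⟩
  · obtain ⟨h1, h2⟩ := hR.abs_le_of_initial hk hac (fun t ht => by positivity) hs0 hq0 x ht
    rw [abs_le] at h1 h2 ⊢
    constructor <;> linarith
  · have hlow := hR.half_sum_ge hk hα (neg_pos.mpr hlam) (M := M) (m := m) (G := G) hs0 hq0
      (by positivity)
      (fun x => by
        rw [hhalf, (hinit x).1]
        exact mul_le_mul_of_nonneg_left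
          (inv_anti₀ (hτ₀pos x) ((le_abs_self _).trans (hτ₀ x).1)) hk.le)
      (fun x => by
        rw [hhalf, show pdx (fun x t => u x t + k * (τ x t)⁻¹) x 0 = _ from
          ((hux x).add (hφx x)).deriv]
        refine hgrad x _ ((abs_add_le _ _).trans (add_le_add (hu₀ x).2 ?_))
        rw [abs_neg]
        exact hφx_abs x)
      (fun x => by
        rw [hhalf, show pdx (fun x t => k * (τ x t)⁻¹ - u x t) x 0 = _ from
          ((hφx x).sub (hux x)).deriv]
        refine hgrad x _ ?_
        rw [abs_neg, ← abs_neg, neg_sub, sub_neg_eq_add]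
        exact (abs_add_le _ _).trans (add_le_add (hu₀ x).2 (hφx_abs x)))
      (E := E) le_rfl x ht
    rw [hhalf, hm, mul_assoc, mul_le_mul_iff_right₀ hk] at hlow
    refine le_trans ?_ hlow
    have h1 := rpow_mul_rpow_mul_le_exp hlam ht
    have h2 : E / k * t ≤ (E + 1) / k * t := by gcongr; linarith
    have h3 : E / k * t * ((1 + t) ^ (-lam) * ((1 + t) ^ (-lam) * (1 + t)))
        ≤ (E + 1) / k * B * t * exp (-lam * (1 + t) ^ (1 - lam) / (1 - lam)) := by
      refine (mul_le_mul h2 h1 (by positivity) (by positivity)).trans_eq ?_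
      ring
    gcongr
end

section
/- Let γ > 1 with γ ≠ 3, λ ≠ 1, and let (τ,u) be a C¹ solution of the system on ℝ × [0,∞) whose Riemann invariants w = u + φ, z = u − φ are twice continuously differentiable. Define y := (φ^{(γ+1)/(2(γ−1))} w_x − (α(γ−1)/(K_c(γ−3)(1+t)^λ)) φ^{(γ−3)/(2(γ−1))}) · E(t) and q := (φ^{(γ+1)/(2(γ−1))} z_x − (α(γ−1)/(K_c(γ−3)(1+t)^λ)) φ^{(γ−3)/(2(γ−1))}) · E(t), where E(t) = exp(α(3γ−1)(1+t)^{1−λ}/(2(γ−3)(1−λ))). Then y′ = a₀ − a₂ y² and q‵ = a₀ − a₂ q², where a₂ = (K_c(γ+1)/(2(γ−1))) φ^{−(γ−3)/(2(γ−1))} E(t)^{−1} > 0 and a₀ = ((λα(γ−1)(γ−3)(1+t)^{λ−1} − α²(γ−1)²)/(K_c(γ−3)²(1+t)^{2λ})) φ^{(γ−3)/(2(γ−1))} E(t). -/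
open Real Set MeasureTheory

/-- Joint `C²` regularity yields the pure and mixed second partial derivatives, the mixed ones
being equal. -/
lemma exists_hasDerivAt_pdx {f : ℝ → ℝ → ℝ} (hf : ContDiff ℝ 2 (fun p : ℝ × ℝ => f p.1 p.2))
    (x t : ℝ) :
    ∃ fxx fxt : ℝ, HasDerivAt (fun y => pdx f y t) fxx x ∧
      HasDerivAt (fun s => pdx f x s) fxt t ∧ HasDerivAt (fun y => pdt f y t) fxt x := by
  set F : ℝ × ℝ → ℝ := fun p => f p.1 p.2 with hF
  have hd : Differentiable ℝ F := hf.differentiable (by norm_num)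
  have hd2 : Differentiable ℝ (fderiv ℝ F) :=
    (hf.fderiv_right (m := 1) (by norm_num)).differentiable (by norm_num)
  have hl : ∀ a b : ℝ, HasDerivAt (fun y : ℝ => (y, b)) ((1, 0) : ℝ × ℝ) a := fun a b =>
    (hasDerivAt_id a).prodMk (hasDerivAt_const a b)
  have hr : ∀ a b : ℝ, HasDerivAt (fun s : ℝ => (a, s)) ((0, 1) : ℝ × ℝ) b := fun a b =>
    (hasDerivAt_const b a).prodMk (hasDerivAt_id b)
  have hx : ∀ a b, pdx f a b = fderiv ℝ F (a, b) (1, 0) := fun a b =>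
    HasDerivAt.deriv (HasFDerivAt.comp_hasDerivAt (f := fun y => (y, b)) a
      (hd (a, b)).hasFDerivAt (hl a b))
  have ht : ∀ a b, pdt f a b = fderiv ℝ F (a, b) (0, 1) := fun a b =>
    HasDerivAt.deriv (HasFDerivAt.comp_hasDerivAt (f := fun r => (a, r)) b
      (hd (a, b)).hasFDerivAt (hr a b))
  have hsymm : IsSymmSndFDerivAt ℝ F (x, t) :=
    hf.contDiffAt.isSymmSndFDerivAt (by simp)
  have hv : ∀ v : ℝ × ℝ, HasFDerivAt (fun p => fderiv ℝ F p v)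
      ((fderiv ℝ (fderiv ℝ F) (x, t)).flip v) (x, t) := fun v =>
    ((ContinuousLinearMap.apply ℝ ℝ v).hasFDerivAt.comp (x, t)
      (hd2 (x, t)).hasFDerivAt).congr_fderiv (by ext <;> simp)
  refine ⟨fderiv ℝ (fderiv ℝ F) (x, t) (1, 0) (1, 0),
    fderiv ℝ (fderiv ℝ F) (x, t) (0, 1) (1, 0), ?_, ?_, ?_⟩
  · simp only [hx]
    exact HasFDerivAt.comp_hasDerivAt (f := fun y => (y, t)) x (hv (1, 0)) (hl x t)
  · simp only [hx]
    exact HasFDerivAt.comp_hasDerivAt (f := fun r => (x, r)) t (hv (1, 0)) (hr x t)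
  · simp only [ht]
    rw [hsymm (0, 1) (1, 0)]
    exact HasFDerivAt.comp_hasDerivAt (f := fun y => (y, t)) x (hv (0, 1)) (hl x t)

lemma hasDerivAt_pdx {f : ℝ → ℝ → ℝ} (hf : ContDiff ℝ 1 (fun p : ℝ × ℝ => f p.1 p.2))
    (x t : ℝ) : HasDerivAt (fun y => f y t) (pdx f x t) x := by
  have : ContDiff ℝ 1 (fun y => f y t) := hf.comp (contDiff_id.prodMk contDiff_const)
  exact (this.differentiable (by norm_num) x).hasDerivAt

lemma hasDerivAt_pdt {f : ℝ → ℝ → ℝ} (hf : ContDiff ℝ 1 (fun p : ℝ × ℝ => f p.1 p.2))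
    (x t : ℝ) : HasDerivAt (fun s => f x s) (pdt f x t) t := by
  have : ContDiff ℝ 1 (fun s => f x s) := hf.comp (contDiff_const.prodMk contDiff_id)
  exact (this.differentiable (by norm_num) t).hasDerivAt

lemma Kc_pos {K γ : ℝ} (hK : 0 < K) (hγ : 1 < γ) : 0 < Kc K γ := by
  have h1 : 0 < γ - 1 := by linarith
  have : 0 < √(K * γ) := Real.sqrt_pos.2 (by positivity)
  unfold Kc Ktau
  positivity

lemma Phi_pos {K γ : ℝ} (hK : 0 < K) (hγ : 1 < γ) {τ : ℝ → ℝ → ℝ} {x t : ℝ} (hτ : 0 < τ x t) :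
    0 < Phi K γ τ x t := by
  have h1 : 0 < γ - 1 := by linarith
  have : 0 < √(K * γ) := Real.sqrt_pos.2 (by positivity)
  unfold Phi
  positivity

/-- The sound speed as a function of `φ`. -/
lemma soundSpeed_eq {K γ : ℝ} (hK : 0 < K) (hγ : 1 < γ) {τ : ℝ → ℝ → ℝ} {x t : ℝ}
    (hτ : 0 < τ x t) :
    √(K * γ) * τ x t ^ (-(γ + 1) / 2) =
      Kc K γ * Phi K γ τ x t ^ (2 * ((γ + 1) / (2 * (γ - 1)))) := by
  have h1 : 0 < γ - 1 := by linarith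
  have h2 : 0 < √(K * γ) := Real.sqrt_pos.2 (by positivity)
  unfold Kc Ktau Phi
  have hA : 0 < 2 * √(K * γ) / (γ - 1) := by positivity
  generalize 2 * √(K * γ) / (γ - 1) = A at hA
  rw [Real.mul_rpow hA.le (by positivity), ← Real.rpow_mul hA.le, ← Real.rpow_mul hτ.le,
    mul_assoc, ← mul_assoc (A ^ _), ← Real.rpow_add hA]
  have e1 : 2 / (γ - 1) * (-(γ + 1) / 2) + 2 * ((γ + 1) / (2 * (γ - 1))) = 0 := by
    field_simp; ring
  have e2 : -(γ - 1) / 2 * (2 * ((γ + 1) / (2 * (γ - 1)))) = -(γ + 1) / 2 := by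
    field_simp
  rw [e1, e2, Real.rpow_zero, one_mul]

/-- Chain rule for `φ` along a curve of positive specific volumes. -/
lemma HasDerivAt.phi {K γ : ℝ} (hγ : 1 < γ) {f : ℝ → ℝ} {f' a : ℝ} (hf : HasDerivAt f f' a)
    (hpos : 0 < f a) :
    HasDerivAt (fun r => (2 * √(K * γ) / (γ - 1)) * f r ^ (-(γ - 1) / 2))
      (-(√(K * γ) * f a ^ (-(γ + 1) / 2)) * f') a := by
  have h1 : γ - 1 ≠ 0 := by linarith
  refine ((hf.rpow_const (p := -(γ - 1) / 2) (Or.inl hpos.ne')).const_mul _).congr_deriv ?_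
  rw [show -(γ - 1) / 2 - 1 = -(γ + 1) / 2 by ring]
  field_simp

/-- The Euler system in the variables `(u, φ)`. -/
lemma IsSol.phi_system {K γ α lam : ℝ} (hK : 0 < K) (hγ : 1 < γ) {τ u : ℝ → ℝ → ℝ}
    (hsol : IsSol K γ α lam τ u) (x t : ℝ) (ht : 0 ≤ t) :
    pdt (Phi K γ τ) x t = -(√(K * γ) * τ x t ^ (-(γ + 1) / 2)) * pdx u x t ∧
    pdt u x t + √(K * γ) * τ x t ^ (-(γ + 1) / 2) * pdx (Phi K γ τ) x t =
      -(α / (1 + t) ^ lam) * u x t := by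
  obtain ⟨hτ, -, hpos, hmass, hmom⟩ := hsol
  have hp := hpos x t ht
  have hτx := hasDerivAt_pdx hτ x t
  have hτt := hasDerivAt_pdt hτ x t
  have hΦt : pdt (Phi K γ τ) x t = _ := (hτt.phi (K := K) hγ hp).deriv
  have hΦx : pdx (Phi K γ τ) x t = _ := (hτx.phi (K := K) hγ hp).deriv
  have hpx : pdx (fun y s => K * τ y s ^ (-γ)) x t = _ :=
    ((hτx.rpow_const (p := -γ) (Or.inl hp.ne')).const_mul K).deriv
  refine ⟨by rw [hΦt, hmass x t ht], ?_⟩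
  rw [← hmom x t ht, hΦx, hpx]
  have hs : √(K * γ) * √(K * γ) = K * γ := Real.mul_self_sqrt (by positivity)
  have hr : τ x t ^ (-(γ + 1) / 2) * τ x t ^ (-(γ + 1) / 2) = τ x t ^ (-γ - 1) := by
    rw [← Real.rpow_add hp]; congr 1; ring
  linear_combination (-pdx τ x t * τ x t ^ (-γ - 1)) * hs -
    (pdx τ x t * √(K * γ) * √(K * γ)) * hr

/-- Decoupled Riccati equation for the weighted gradient of a Riemann invariant `f`, with `g` the
opposite invariant and `s = ±1` the sign of the characteristic family carrying `f`. -/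
lemma riccati {k γ α lam s : ℝ} (hk : 0 < k) (hγ : 1 < γ) (hγ3 : γ ≠ 3) (hlam : lam ≠ 1)
    (hs : s = 1 ∨ s = -1) {Φ fx : ℝ → ℝ → ℝ} {x t : ℝ} (ht : 0 ≤ t) (hΦ : 0 < Φ x t)
    {Φx Φt gx fxx fxt : ℝ}
    (hΦx : HasDerivAt (fun y => Φ y t) Φx x) (hΦt : HasDerivAt (fun r => Φ x r) Φt t)
    (hfxx : HasDerivAt (fun y => fx y t) fxx x) (hfxt : HasDerivAt (fun r => fx x r) fxt t)
    (hΦs : Φx = s * (fx x t - gx) / 2)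
    (hΦ' : Φt = -(k * Φ x t ^ (2 * ((γ + 1) / (2 * (γ - 1))))) * ((fx x t + gx) / 2))
    (hf' : fxt + s * ((k * (Φx * (2 * ((γ + 1) / (2 * (γ - 1)))) *
        Φ x t ^ (2 * ((γ + 1) / (2 * (γ - 1))) - 1))) * fx x t +
        k * Φ x t ^ (2 * ((γ + 1) / (2 * (γ - 1)))) * fxx) =
      -(α / (1 + t) ^ lam) * ((fx x t + gx) / 2))
    {E : ℝ → ℝ}
    (hE : E = fun t => Real.exp (α * (3 * γ - 1) * (1 + t) ^ (1 - lam) /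
      (2 * (γ - 3) * (1 - lam))))
    {Y : ℝ → ℝ → ℝ}
    (hY : Y = fun x t =>
      (Φ x t ^ ((γ + 1) / (2 * (γ - 1))) * fx x t -
        α * (γ - 1) / (k * (γ - 3) * (1 + t) ^ lam) * Φ x t ^ ((γ - 3) / (2 * (γ - 1)))) * E t) :
    pdt Y x t + s * (k * Φ x t ^ (2 * ((γ + 1) / (2 * (γ - 1))))) * pdx Y x t =
      (lam * α * (γ - 1) * (γ - 3) * (1 + t) ^ (lam - 1) - α ^ 2 * (γ - 1) ^ 2) /
        (k * (γ - 3) ^ 2 * (1 + t) ^ (2 * lam)) * Φ x t ^ ((γ - 3) / (2 * (γ - 1))) * E t -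
      k * (γ + 1) / (2 * (γ - 1)) * Φ x t ^ (-(γ - 3) / (2 * (γ - 1))) * (E t)⁻¹ *
        Y x t ^ 2 := by
  have h1 : γ - 1 ≠ 0 := by linarith
  have h3 : γ - 3 ≠ 0 := sub_ne_zero.2 hγ3
  have hl : 1 - lam ≠ 0 := sub_ne_zero.2 hlam.symm
  have hT : 0 < 1 + t := by linarith
  have hTd : HasDerivAt (fun r : ℝ => 1 + r) 1 t := (hasDerivAt_id t).const_add 1
  have hLpos : 0 < (1 + t) ^ lam := Real.rpow_pos_of_pos hT _
  have hEd : HasDerivAt E (E t * (α * (3 * γ - 1) / (2 * (γ - 3) * (1 + t) ^ lam))) t := by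
    have := ((((hTd.rpow_const (p := 1 - lam) (Or.inl hT.ne')).const_mul
      (α * (3 * γ - 1))).div_const (2 * (γ - 3) * (1 - lam))).exp)
    rw [hE]
    refine this.congr_deriv ?_
    rw [show (1 : ℝ) - lam - 1 = -lam by ring, Real.rpow_neg hT.le]
    field_simp
  have hEpos : 0 < E t := by rw [hE]; positivity
  have hLd : HasDerivAt (fun r : ℝ => (1 + r) ^ lam) (lam * ((1 + t) ^ lam / (1 + t))) t := by
    refine (hTd.rpow_const (p := lam) (Or.inl hT.ne')).congr_deriv ?_
    rw [Real.rpow_sub_one hT.ne']; ring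
  have hBd : HasDerivAt (fun r : ℝ => α * (γ - 1) / (k * (γ - 3) * (1 + r) ^ lam))
      (-(lam * (α * (γ - 1) / (k * (γ - 3) * (1 + t) ^ lam)) / (1 + t))) t := by
    refine ((hasDerivAt_const t (α * (γ - 1))).fun_div (hLd.const_mul (k * (γ - 3)))
      (by positivity)).congr_deriv ?_
    field_simp
    ring
  have hYt := (((hΦt.rpow_const (p := (γ + 1) / (2 * (γ - 1))) (Or.inl hΦ.ne')).fun_mul
    hfxt).fun_sub (hBd.fun_mul
      (hΦt.rpow_const (p := (γ - 3) / (2 * (γ - 1))) (Or.inl hΦ.ne')))).fun_mul hEd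
  have hYx := (((hΦx.rpow_const (p := (γ + 1) / (2 * (γ - 1))) (Or.inl hΦ.ne')).fun_mul
    hfxx).fun_sub ((hΦx.rpow_const (p := (γ - 3) / (2 * (γ - 1))) (Or.inl hΦ.ne')).const_mul
      (α * (γ - 1) / (k * (γ - 3) * (1 + t) ^ lam)))).mul_const (E t)
  have hYt' := (hYt.congr_of_eventuallyEq (f₁ := fun r => Y x r)
    (Filter.Eventually.of_forall fun r => by rw [hY])).deriv
  have hYx' := (hYx.congr_of_eventuallyEq (f₁ := fun y => Y y t)
    (Filter.Eventually.of_forall fun y => by rw [hY])).deriv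
  change pdt Y x t = _ at hYt'
  change pdx Y x t = _ at hYx'
  rw [hYt', hYx']
  have hYv : Y x t = (Φ x t ^ ((γ + 1) / (2 * (γ - 1))) * fx x t -
        α * (γ - 1) / (k * (γ - 3) * (1 + t) ^ lam) *
          Φ x t ^ ((γ - 3) / (2 * (γ - 1)))) * E t := by rw [hY]
  rw [hYv]
  clear hYv hYt' hYx' hYt hYx hY hE hEd hBd hLd hΦt hΦx hfxx hfxt
  have hmn : Φ x t ^ ((γ + 1) / (2 * (γ - 1))) * Φ x t ^ ((γ - 3) / (2 * (γ - 1))) = Φ x t := by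
    rw [← Real.rpow_add hΦ]
    conv_rhs => rw [← Real.rpow_one (Φ x t)]
    congr 1
    field_simp
    ring
  have h2m : Φ x t ^ (2 * ((γ + 1) / (2 * (γ - 1)))) = (Φ x t ^ ((γ + 1) / (2 * (γ - 1)))) ^ 2 := by
    rw [mul_comm, Real.rpow_mul hΦ.le]; norm_cast
  have h2l : (1 + t) ^ (2 * lam) = ((1 + t) ^ lam) ^ 2 := by
    rw [mul_comm, Real.rpow_mul hT.le]; norm_cast
  rw [neg_div, Real.rpow_neg hΦ.le]
  rw [Real.rpow_sub_one hΦ.ne'] at hf'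
  simp only [Real.rpow_sub_one hΦ.ne', Real.rpow_sub_one hT.ne', h2m, h2l] at hf' hΦ' ⊢
  have hQ : 0 < Φ x t ^ ((γ + 1) / (2 * (γ - 1))) := Real.rpow_pos_of_pos hΦ _
  have hR : 0 < Φ x t ^ ((γ - 3) / (2 * (γ - 1))) := Real.rpow_pos_of_pos hΦ _
  generalize Φ x t ^ ((γ + 1) / (2 * (γ - 1))) = Q at *
  generalize Φ x t ^ ((γ - 3) / (2 * (γ - 1))) = R at *
  generalize (1 + t) ^ lam = L at *
  generalize E t = e at *
  generalize fx x t = p at *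
  generalize 1 + t = T at *
  rw [← hmn] at hf' ⊢
  have hfxt' := eq_sub_of_add_eq hf'
  subst hΦ' hfxt' hΦs
  rcases hs with rfl | rfl
  · field_simp
    ring
  · field_simp
    ring

theorem stmt11 (K γ α lam : ℝ) (hK : 0 < K) (hγ : 1 < γ) (hγ3 : γ ≠ 3) (hlam : lam ≠ 1)
    (τ u : ℝ → ℝ → ℝ) (hsol : IsSol K γ α lam τ u)
    (w z : ℝ → ℝ → ℝ)
    (hw : w = fun x t => u x t + Phi K γ τ x t)
    (hz : z = fun x t => u x t - Phi K γ τ x t)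
    (hw2 : ContDiff ℝ 2 (fun p : ℝ × ℝ => w p.1 p.2))
    (hz2 : ContDiff ℝ 2 (fun p : ℝ × ℝ => z p.1 p.2))
    (c : ℝ → ℝ → ℝ)
    (hc : c = fun x t => Real.sqrt (K * γ) * τ x t ^ (-(γ + 1) / 2))
    (E : ℝ → ℝ)
    (hE : E = fun t => Real.exp (α * (3 * γ - 1) * (1 + t) ^ (1 - lam) /
      (2 * (γ - 3) * (1 - lam))))
    (y q a₀ a₂ : ℝ → ℝ → ℝ)
    (hy : y = fun x t =>
      (Phi K γ τ x t ^ ((γ + 1) / (2 * (γ - 1))) * pdx w x t -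
        α * (γ - 1) / (Kc K γ * (γ - 3) * (1 + t) ^ lam) *
          Phi K γ τ x t ^ ((γ - 3) / (2 * (γ - 1)))) * E t)
    (hq : q = fun x t =>
      (Phi K γ τ x t ^ ((γ + 1) / (2 * (γ - 1))) * pdx z x t -
        α * (γ - 1) / (Kc K γ * (γ - 3) * (1 + t) ^ lam) *
          Phi K γ τ x t ^ ((γ - 3) / (2 * (γ - 1)))) * E t)
    (ha₂ : a₂ = fun x t =>
      Kc K γ * (γ + 1) / (2 * (γ - 1)) * Phi K γ τ x t ^ (-(γ - 3) / (2 * (γ - 1))) * (E t)⁻¹)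
    (ha₀ : a₀ = fun x t =>
      (lam * α * (γ - 1) * (γ - 3) * (1 + t) ^ (lam - 1) - α ^ 2 * (γ - 1) ^ 2) /
        (Kc K γ * (γ - 3) ^ 2 * (1 + t) ^ (2 * lam)) *
        Phi K γ τ x t ^ ((γ - 3) / (2 * (γ - 1))) * E t)
    (x t : ℝ) (ht : 0 ≤ t) :
    0 < a₂ x t ∧
    pdt y x t + c x t * pdx y x t = a₀ x t - a₂ x t * y x t ^ 2 ∧
    pdt q x t - c x t * pdx q x t = a₀ x t - a₂ x t * q x t ^ 2 := by
  have hpos := hsol.2.2.1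
  have hk : 0 < Kc K γ := Kc_pos hK hγ
  have hΦpos : ∀ y, 0 < Phi K γ τ y t := fun y => Phi_pos hK hγ (hpos y t ht)
  have hγ1 : 0 < γ - 1 := by linarith
  have hw1 := hw2.of_le one_le_two
  have hu1 : ContDiff ℝ 1 (fun p : ℝ × ℝ => u p.1 p.2) := hsol.2.1
  have hΦ1 : ContDiff ℝ 1 (fun p : ℝ × ℝ => Phi K γ τ p.1 p.2) := by
    have : (fun p : ℝ × ℝ => Phi K γ τ p.1 p.2) =
        fun p : ℝ × ℝ => w p.1 p.2 - u p.1 p.2 := by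
      simp [hw]
    rw [this]
    exact hw1.sub hu1
  have hcΦ : ∀ y, c y t = Kc K γ * Phi K γ τ y t ^ (2 * ((γ + 1) / (2 * (γ - 1)))) := fun y => by
    rw [hc]; exact soundSpeed_eq hK hγ (hpos y t ht)
  have hux := fun y => hasDerivAt_pdx hu1 y t
  have hut := fun y => hasDerivAt_pdt hu1 y t
  have hΦx := fun y => hasDerivAt_pdx hΦ1 y t
  have hΦt := fun y => hasDerivAt_pdt hΦ1 y t
  have hwx : ∀ y, pdx w y t = pdx u y t + pdx (Phi K γ τ) y t := fun y => by
    rw [hw]; exact ((hux y).fun_add (hΦx y)).deriv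
  have hwt : ∀ y, pdt w y t = pdt u y t + pdt (Phi K γ τ) y t := fun y => by
    rw [hw]; exact ((hut y).fun_add (hΦt y)).deriv
  have hzx : ∀ y, pdx z y t = pdx u y t - pdx (Phi K γ τ) y t := fun y => by
    rw [hz]; exact ((hux y).fun_sub (hΦx y)).deriv
  have hzt : ∀ y, pdt z y t = pdt u y t - pdt (Phi K γ τ) y t := fun y => by
    rw [hz]; exact ((hut y).fun_sub (hΦt y)).deriv
  have hsys : ∀ y, pdt (Phi K γ τ) y t = -c y t * pdx u y t ∧
      pdt u y t + c y t * pdx (Phi K γ τ) y t = -(α / (1 + t) ^ lam) * u y t := fun y => by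
    rw [hc]; exact hsol.phi_system hK hγ y t ht
  have hcd := (((hΦx x).rpow_const (p := 2 * ((γ + 1) / (2 * (γ - 1))))
    (Or.inl (hΦpos x).ne')).const_mul (Kc K γ)).congr_of_eventuallyEq
      (Filter.Eventually.of_forall hcΦ)
  obtain ⟨wxx, wxt, hwxx, hwxt, hwtx⟩ := exists_hasDerivAt_pdx hw2 x t
  obtain ⟨zxx, zxt, hzxx, hzxt, hztx⟩ := exists_hasDerivAt_pdx hz2 x t
  have hrhs := (hux x).const_mul (-(α / (1 + t) ^ lam))
  have hweq := (hwtx.fun_add ((hcd.fun_mul hwxx).const_mul 1)).unique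
    (hrhs.congr_of_eventuallyEq (Filter.Eventually.of_forall fun y => by
      simp only [hwt, hwx]
      linear_combination (hsys y).1 + (hsys y).2))
  have hzeq := (hztx.fun_add ((hcd.fun_mul hzxx).const_mul (-1))).unique
    (hrhs.congr_of_eventuallyEq (Filter.Eventually.of_forall fun y => by
      simp only [hzt, hzx]
      linear_combination (hsys y).2 - (hsys y).1))
  simp only [hcΦ] at hweq hzeq hsys
  have hΦt' := (hsys x).1
  refine ⟨?_, ?_, ?_⟩
  · have := hΦpos x
    rw [ha₂, hE]
    positivity
  · rw [ha₀, ha₂, hcΦ]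
    have := riccati (gx := pdx z x t) (α := α) hk hγ hγ3 hlam (Or.inl rfl) ht (hΦpos x) (hΦx x)
      (hΦt x) hwxx hwxt (by rw [hwx, hzx]; ring) (by rw [hΦt', hwx, hzx]; ring)
      (by rw [hweq, hwx, hzx]; ring) hE hy
    rwa [one_mul] at this
  · rw [ha₀, ha₂, hcΦ]
    have := riccati (gx := pdx w x t) (α := α) hk hγ hγ3 hlam (Or.inr rfl) ht (hΦpos x) (hΦx x)
      (hΦt x) hzxx hzxt (by rw [hwx, hzx]; ring) (by rw [hΦt', hwx, hzx]; ring)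
      (by rw [hzeq, hwx, hzx]; ring) hE hq
    rwa [neg_one_mul, neg_mul, ← sub_eq_add_neg] at this
end
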